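/- arXiv:2404.12733 — 8 statements merged into one kernel-verified Lean document; each statement's English description precedes it below -/
import Mathlib

section
/- For every real number x, one has x·tanh(x) = ∑_{k∈ℤ} 4x² / ((2k−1)²π² + 4x²), where the series over k∈ℤ converges absolutely. -/
open Real

/-- The Mittag-Leffler expansion of `x * coth x`, over the positive integers. -/
lemma hasSum_mul_coth_sub_one {x : ℝ} (hx : x ≠ 0) :
    HasSum (fun n : ℕ => 2 * x ^ 2 / (((n : ℝ) + 1) ^ 2 * π ^ 2 + x ^ 2))
      (x * (Real.cosh x / Real.sinh x) - 1) := by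
  set z : ℂ := ((x / π : ℝ) : ℂ) * Complex.I with hzdef
  have hz : z ∈ Complex.integerComplement := by
    rintro ⟨n, hn⟩
    have him := congrArg Complex.im hn
    have hne : x / π ≠ 0 := div_ne_zero hx Real.pi_ne_zero
    simp [hzdef] at him
    tauto
  have hcot := ((summable_cotTerm hz).hasSum_iff_tendsto_nat.mpr
    (tendsto_logDeriv_euler_cot_sub hz)).mul_left z
  have hpz : (π : ℂ) * z = x * Complex.I := by
    rw [hzdef]; push_cast; field_simp
  have hval : z * (π * Complex.cot (π * z) - 1 / z) =
      ((x * (Real.cosh x / Real.sinh x) - 1 : ℝ) : ℂ) := by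
    have hz0 : z ≠ 0 := Complex.integerComplement.ne_zero hz
    have hmul : z * (π * Complex.cot (π * z) - 1 / z) =
        (π * z) * Complex.cot (π * z) - 1 := by field_simp
    rw [hmul, hpz, Complex.cot, Complex.cos_mul_I, Complex.sin_mul_I]
    push_cast
    field_simp
  rw [hval] at hcot
  refine Complex.hasSum_ofReal.mp (hcot.congr_fun fun n => ?_)
  have hsub : z - (n + 1) ≠ 0 := by
    simpa [sub_eq_add_neg] using Complex.integerComplement_add_ne_zero hz (-(n + 1) : ℤ)
  have hadd : z + (n + 1) ≠ 0 := by
    simpa using Complex.integerComplement_add_ne_zero hz ((n : ℤ) + 1)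
  have hsq : (x : ℂ) ^ 2 = -π ^ 2 * z ^ 2 := by
    linear_combination (π * z + x * Complex.I) * hpz + x ^ 2 * Complex.I_sq
  have hfactor : ((n : ℂ) + 1) ^ 2 * π ^ 2 + x ^ 2 =
      -π ^ 2 * ((z + (n + 1)) * (z - (n + 1))) := by
    linear_combination hsq
  rw [cotTerm_identity hz]
  push_cast
  rw [hfactor, hsq]
  field_simp

/-- The Mittag-Leffler expansion of `x * tanh x`, over the odd natural numbers. -/
lemma hasSum_mul_tanh_div_two (x : ℝ) :
    HasSum (fun n : ℕ => 4 * x ^ 2 / ((2 * (n : ℝ) + 1) ^ 2 * π ^ 2 + 4 * x ^ 2))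
      (x * Real.tanh x / 2) := by
  rcases eq_or_ne x 0 with rfl | hx
  · simp
  have hsinh : Real.sinh x ≠ 0 := Real.sinh_ne_zero.mpr hx
  set g : ℕ → ℝ := fun n => 4 * x ^ 2 / (((n : ℝ) + 1) ^ 2 * π ^ 2 + 4 * x ^ 2) with hg
  have hall : HasSum g ((2 * x * (Real.cosh (2 * x) / Real.sinh (2 * x)) - 1) / 2) := by
    refine ((hasSum_mul_coth_sub_one (mul_ne_zero two_ne_zero hx)).div_const 2).congr_fun
      fun n => ?_
    simp only [hg]
    ring
  have hodd : HasSum (fun n => g (2 * n + 1)) ((x * (Real.cosh x / Real.sinh x) - 1) / 2) := by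
    refine ((hasSum_mul_coth_sub_one hx).div_const 2).congr_fun fun n => ?_
    have : ((n : ℝ) + 1) ^ 2 * π ^ 2 + x ^ 2 ≠ 0 := by positivity
    have : ((2 * n + 1 : ℝ) + 1) ^ 2 * π ^ 2 + 4 * x ^ 2 ≠ 0 := by positivity
    simp only [hg]
    push_cast
    field_simp
    ring
  have heven : Summable fun n => g (2 * n) :=
    hall.summable.comp_injective (mul_right_injective₀ two_ne_zero)
  have htotal := (heven.hasSum.even_add_odd hodd).unique hall
  have hsum : ∑' n, g (2 * n) = x * Real.tanh x / 2 := by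
    rw [eq_sub_of_add_eq htotal, Real.tanh_eq_sinh_div_cosh, Real.sinh_two_mul, Real.cosh_two_mul]
    field_simp
    ring
  rw [← hsum]
  exact heven.hasSum.congr_fun fun n => by simp [hg]

/-- For every real `x`, `x * tanh x = ∑_{k ∈ ℤ} 4x² / ((2k-1)²π² + 4x²)`,
the series over `k ∈ ℤ` converging absolutely. -/
theorem tanh_mittag_leffler (x : ℝ) :
    Summable (fun k : ℤ => |4 * x ^ 2 / ((2 * (k : ℝ) - 1) ^ 2 * π ^ 2 + 4 * x ^ 2)|) ∧
    x * Real.tanh x = ∑' k : ℤ, 4 * x ^ 2 / ((2 * (k : ℝ) - 1) ^ 2 * π ^ 2 + 4 * x ^ 2) := by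
  have hnat := hasSum_mul_tanh_div_two x
  have hshift : HasSum (fun k : ℤ => 4 * x ^ 2 / ((2 * (k : ℝ) + 1) ^ 2 * π ^ 2 + 4 * x ^ 2))
      (x * Real.tanh x / 2 + x * Real.tanh x / 2) := by
    refine HasSum.of_nat_of_neg_add_one (by simpa using hnat) (hnat.congr_fun fun n => ?_)
    push_cast
    ring
  have hint : HasSum (fun k : ℤ => 4 * x ^ 2 / ((2 * (k : ℝ) - 1) ^ 2 * π ^ 2 + 4 * x ^ 2))
      (x * Real.tanh x) := by
    rw [← add_halves (x * Real.tanh x)]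
    refine ((Equiv.subRight (1 : ℤ)).hasSum_iff.mpr hshift).congr_fun fun k => ?_
    simp only [Function.comp_apply, Equiv.subRight_apply]
    push_cast
    ring
  exact ⟨hint.summable.abs, hint.tsum_eq.symm⟩
end

section
/- Let c₀, c₁, c₂ be real numbers with c₀ + c₁ + c₂ = 0 and let M₀, M₁, M₂ > 0. Then the function s ↦ (c₀ e^{−sM₀} + c₁ e^{−sM₁} + c₂ e^{−sM₂})/s is integrable on (0,∞) and ∫₀^∞ (∑_{j=0}^2 c_j e^{−sM_j}) s^{−1} ds = − ∑_{j=0}^2 c_j log(M_j). -/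
open Real MeasureTheory

/-- The Frullani integrand of the decaying exponential is integrable on `(0, ∞)`. -/
theorem integrableOn_inv_smul_exp_neg_sub {a b : ℝ} (ha : 0 < a) (hb : 0 < b) :
    IntegrableOn (fun x : ℝ => x⁻¹ • (Real.exp (-(a * x)) - Real.exp (-(b * x)))) (Set.Ioi 0) := by
  wlog hab : a ≤ b generalizing a b
  · refine (this hb ha (le_of_not_ge hab)).neg.congr_fun (fun x _ => ?_) measurableSet_Ioi
    simp only [Pi.neg_apply, smul_eq_mul]
    ring
  have hbound : IntegrableOn (fun x : ℝ => (b - a) * Real.exp (-a * x)) (Set.Ioi 0) :=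
    (exp_neg_integrableOn_Ioi 0 ha).const_mul _
  refine hbound.mono' (by fun_prop) (ae_restrict_of_forall_mem measurableSet_Ioi fun x hx => ?_)
  have hx : 0 < x := hx
  have hle : Real.exp (-(b * x)) ≤ Real.exp (-(a * x)) := by gcongr
  have hmul : Real.exp (-(b * x)) = Real.exp (-(a * x)) * Real.exp (-((b - a) * x)) := by
    rw [← Real.exp_add]
    ring_nf
  have hupper : Real.exp (-(a * x)) - Real.exp (-(b * x))
      ≤ x * ((b - a) * Real.exp (-(a * x))) := by
    have := mul_le_mul_of_nonneg_left (Real.add_one_le_exp (-((b - a) * x)))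
      (Real.exp_nonneg (-(a * x)))
    rw [hmul]
    linarith
  rw [smul_eq_mul, Real.norm_of_nonneg (mul_nonneg (inv_nonneg.2 hx.le) (sub_nonneg.2 hle)),
    neg_mul, inv_mul_le_iff₀ hx]
  exact hupper

/-- **Frullani's integral** for the decaying exponential. -/
theorem integral_Ioi_inv_smul_exp_neg_sub {a b : ℝ} (ha : 0 < a) (hb : 0 < b) :
    ∫ x in Set.Ioi (0 : ℝ), x⁻¹ • (Real.exp (-(a * x)) - Real.exp (-(b * x)))
      = Real.log (b / a) := by
  have hcont : Continuous fun x : ℝ => Real.exp (-x) := by fun_prop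
  have hzero := (hcont.tendsto 0).mono_left (nhdsWithin_le_nhds (s := Set.Ioi 0))
  simpa using Frullani.integral_Ioi_eq (f := fun x : ℝ => Real.exp (-x))
    (hcont.locallyIntegrable.locallyIntegrableOn _) ha hb hzero
    Real.tendsto_exp_neg_atTop_nhds_zero (integrableOn_inv_smul_exp_neg_sub ha hb)

/-- Frullani-type identity: if `c₀ + c₁ + c₂ = 0` and `M₀, M₁, M₂ > 0`, then
`s ↦ (∑_j c_j e^{-s M_j})/s` is integrable on `(0,∞)` and
`∫₀^∞ (∑_j c_j e^{-s M_j}) s⁻¹ ds = -∑_j c_j log M_j`. -/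
theorem frullani_exp_sum (c M : Fin 3 → ℝ) (hc : ∑ j, c j = 0) (hM : ∀ j, 0 < M j) :
    IntegrableOn (fun s : ℝ => (∑ j, c j * Real.exp (-s * M j)) / s) (Set.Ioi 0) ∧
    (∫ s in Set.Ioi (0 : ℝ), (∑ j, c j * Real.exp (-s * M j)) * s⁻¹)
      = -∑ j, c j * Real.log (M j) := by
  have hsum (s : ℝ) : (∑ j, c j * Real.exp (-s * M j)) * s⁻¹
      = ∑ j, c j * (s⁻¹ • (Real.exp (-(M j * s)) - Real.exp (-(1 * s)))) := by
    calc (∑ j, c j * Real.exp (-s * M j)) * s⁻¹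
      _ = (∑ j, c j * Real.exp (-s * M j)) * s⁻¹ - (∑ j, c j) * (s⁻¹ * Real.exp (-(1 * s))) := by
        rw [hc, zero_mul, sub_zero]
      _ = _ := by
        rw [Finset.sum_mul, Finset.sum_mul, ← Finset.sum_sub_distrib]
        refine Finset.sum_congr rfl fun j _ => ?_
        rw [neg_mul, mul_comm s, smul_eq_mul]
        ring
  have hint (j : Fin 3) : IntegrableOn
      (fun s : ℝ => c j * (s⁻¹ • (Real.exp (-(M j * s)) - Real.exp (-(1 * s))))) (Set.Ioi 0) :=
    (integrableOn_inv_smul_exp_neg_sub (hM j) one_pos).const_mul _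
  simp_rw [div_eq_mul_inv, hsum]
  refine ⟨integrable_finsetSum _ fun j _ => hint j, ?_⟩
  rw [integral_finsetSum _ fun j _ => hint j, ← Finset.sum_neg_distrib]
  refine Finset.sum_congr rfl fun j _ => ?_
  rw [integral_const_mul, integral_Ioi_inv_smul_exp_neg_sub (hM j) one_pos, one_div,
    Real.log_inv, mul_neg]
end

section
/- Let c₀ = 1, c₁, c₂ be real numbers and 0 < m₀ < m₁ < m₂ satisfy ∑_{j=0}^2 c_j = 0 and ∑_{j=0}^2 c_j m_j² = 0, and define Λ > 0 by log(Λ²) = −∑_{j=0}^2 c_j log(m_j²). Define, for q ∈ ℝ³, M⁰(q) = −(2/π) ∫₀¹ ∑_{j=0}^2 c_j log(m_j² + u(1−u)|q|²) · u(1−u) du. Then M⁰ is well defined and satisfies 0 < M⁰(q) ≤ M⁰(0) = (2 log Λ)/(3π) for every q ∈ ℝ³. -/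
open Real MeasureTheory

/-- The dielectric response of Dirac's vacuum at zero temperature, with Pauli-Villars
coefficients `c` and masses `m`:
`M⁰(q) = -(2/π) ∫₀¹ ∑_j c_j log(m_j² + u(1-u)|q|²) u(1-u) du`. -/
noncomputable def M0 (c m : Fin 3 → ℝ) (q : EuclideanSpace ℝ (Fin 3)) : ℝ :=
  -(2 / π) * ∫ u in Set.Ioo (0 : ℝ) 1,
    (∑ j, c j * Real.log ((m j) ^ 2 + u * (1 - u) * ‖q‖ ^ 2)) * (u * (1 - u))

/-- For a positively ordered triple of masses satisfying the Pauli-Villars conditions, the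
coefficients are determined by the squared masses. -/
lemma pauliVillars_coeff {c m : Fin 3 → ℝ} (hc0 : c 0 = 1)
    (hm0 : 0 < m 0) (hm01 : m 0 < m 1) (hm12 : m 1 < m 2)
    (hc : ∑ j, c j = 0) (hcm : ∑ j, c j * (m j) ^ 2 = 0) :
    (m 0) ^ 2 < (m 1) ^ 2 ∧ (m 1) ^ 2 < (m 2) ^ 2 ∧
    c 1 = -(((m 2) ^ 2 - (m 0) ^ 2) / ((m 2) ^ 2 - (m 1) ^ 2)) ∧
    c 2 = ((m 1) ^ 2 - (m 0) ^ 2) / ((m 2) ^ 2 - (m 1) ^ 2) := by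
  have hab : (m 0) ^ 2 < (m 1) ^ 2 := by gcongr
  have hbd : (m 1) ^ 2 < (m 2) ^ 2 := by
    have := hm0.trans hm01
    gcongr
  have hne : (m 2) ^ 2 - (m 1) ^ 2 ≠ 0 := (sub_pos.2 hbd).ne'
  rw [Fin.sum_univ_three, hc0] at hc hcm
  refine ⟨hab, hbd, ?_, ?_⟩
  · rw [← neg_div, eq_div_iff hne]
    linear_combination (m 2) ^ 2 * hc - hcm
  · rw [eq_div_iff hne]
    linear_combination hcm - (m 1) ^ 2 * hc

/-- The regularized logarithm is negative. -/
lemma sum_mul_log_neg {c m : Fin 3 → ℝ} (hc0 : c 0 = 1)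
    (hm0 : 0 < m 0) (hm01 : m 0 < m 1) (hm12 : m 1 < m 2)
    (hc : ∑ j, c j = 0) (hcm : ∑ j, c j * (m j) ^ 2 = 0) {s : ℝ} (hs : 0 ≤ s) :
    ∑ j, c j * Real.log ((m j) ^ 2 + s) < 0 := by
  obtain ⟨hab, hbd, h1, h2⟩ := pauliVillars_coeff hc0 hm0 hm01 hm12 hc hcm
  have ha : 0 < (m 0) ^ 2 := by positivity
  rw [Fin.sum_univ_three, hc0, h1, h2]
  generalize (m 0) ^ 2 = a at *
  generalize (m 1) ^ 2 = b at *
  generalize (m 2) ^ 2 = d at *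
  have hdb : 0 < d - b := sub_pos.2 hbd
  have hda : 0 < d - a := by linarith
  have hba : 0 < b - a := by linarith
  have key := strictConcaveOn_log_Ioi.2 (x := a + s) (y := d + s)
    (Set.mem_Ioi.2 (by linarith)) (Set.mem_Ioi.2 (by linarith)) (by linarith)
    (div_pos hdb hda) (div_pos hba hda) (by field_simp; ring)
  simp only [smul_eq_mul] at key
  have hcomb : (d - b) / (d - a) * (a + s) + (b - a) / (d - a) * (d + s) = b + s := by
    field_simp
    ring
  rw [hcomb] at key
  have hrw : 1 * Real.log (a + s) + -((d - a) / (d - b)) * Real.log (b + s)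
      + (b - a) / (d - b) * Real.log (d + s)
      = (d - a) / (d - b) * ((d - b) / (d - a) * Real.log (a + s)
        + (b - a) / (d - a) * Real.log (d + s) - Real.log (b + s)) := by
    field_simp
    ring
  rw [hrw]
  exact mul_neg_of_pos_of_neg (div_pos hda hdb) (sub_neg.2 key)

/-- The regularized logarithm increases with the momentum. -/
lemma sum_mul_log_le {c m : Fin 3 → ℝ} (hc0 : c 0 = 1)
    (hm0 : 0 < m 0) (hm01 : m 0 < m 1) (hm12 : m 1 < m 2)
    (hc : ∑ j, c j = 0) (hcm : ∑ j, c j * (m j) ^ 2 = 0) {s : ℝ} (hs : 0 ≤ s) :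
    ∑ j, c j * Real.log ((m j) ^ 2) ≤ ∑ j, c j * Real.log ((m j) ^ 2 + s) := by
  obtain ⟨hab, hbd, h1, h2⟩ := pauliVillars_coeff hc0 hm0 hm01 hm12 hc hcm
  have ha : 0 < (m 0) ^ 2 := by positivity
  have hpos : ∀ j, 0 < (m j) ^ 2 := by
    intro j
    fin_cases j
    exacts [ha, ha.trans hab, (ha.trans hab).trans hbd]
  have hd : ∀ t : ℝ, 0 ≤ t → HasDerivAt (fun t => ∑ j, c j * Real.log ((m j) ^ 2 + t))
      (∑ j, c j * (1 / ((m j) ^ 2 + t))) t := by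
    intro t ht
    refine HasDerivAt.fun_sum fun j _ => HasDerivAt.const_mul _ ?_
    exact ((hasDerivAt_id t).const_add _).log (by have := hpos j; simp only [id]; positivity)
  have hmono : MonotoneOn (fun t => ∑ j, c j * Real.log ((m j) ^ 2 + t)) (Set.Ici 0) := by
    refine monotoneOn_of_deriv_nonneg (convex_Ici 0)
      (fun t ht => (hd t ht).continuousAt.continuousWithinAt)
      (fun t ht => (hd t (interior_subset ht)).differentiableAt.differentiableWithinAt) ?_
    intro t ht
    have ht : 0 ≤ t := interior_subset ht
    rw [(hd t ht).deriv, Fin.sum_univ_three, hc0, h1, h2]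
    generalize (m 0) ^ 2 = a at *
    generalize (m 1) ^ 2 = b at *
    generalize (m 2) ^ 2 = d at *
    have hdb : 0 < d - b := sub_pos.2 hbd
    have hda : 0 < d - a := by linarith
    have hba : 0 < b - a := by linarith
    have hat : 0 < a + t := by linarith
    have hbt : 0 < b + t := by linarith
    have hdt : 0 < d + t := by linarith
    have : 1 * (1 / (a + t)) + -((d - a) / (d - b)) * (1 / (b + t))
        + (b - a) / (d - b) * (1 / (d + t))
        = (b - a) * (d - a) / ((a + t) * (b + t) * (d + t)) := by
      field_simp
      ring
    rw [this]
    positivity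
  simpa using hmono (Set.mem_Ici.2 le_rfl) (Set.mem_Ici.2 hs) hs

/-- The integrand defining `M0` is interval integrable. -/
lemma intervalIntegrable_M0 (c : Fin 3 → ℝ) {m : Fin 3 → ℝ} (hm : ∀ j, 0 < m j)
    (q : EuclideanSpace ℝ (Fin 3)) :
    IntervalIntegrable (fun u : ℝ =>
      (∑ j, c j * Real.log ((m j) ^ 2 + u * (1 - u) * ‖q‖ ^ 2)) * (u * (1 - u)))
      volume 0 1 := by
  refine ContinuousOn.intervalIntegrable ?_
  rw [Set.uIcc_of_le zero_le_one]
  refine ContinuousOn.mul (continuousOn_finsetSum _ fun j _ => continuousOn_const.mul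
    (ContinuousOn.log (by fun_prop) ?_)) (by fun_prop)
  rintro u ⟨hu0, hu1⟩
  have := hm j
  have := sub_nonneg.2 hu1
  positivity

lemma M0_eq_intervalIntegral (c m : Fin 3 → ℝ) (q : EuclideanSpace ℝ (Fin 3)) :
    M0 c m q = -(2 / π) * ∫ u in (0 : ℝ)..1,
      (∑ j, c j * Real.log ((m j) ^ 2 + u * (1 - u) * ‖q‖ ^ 2)) * (u * (1 - u)) := by
  rw [M0, intervalIntegral.integral_of_le zero_le_one, integral_Ioc_eq_integral_Ioo]

/-- Under the Pauli-Villars conditions, `M⁰` is well defined and satisfies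
`0 < M⁰(q) ≤ M⁰(0) = (2 log Λ)/(3π)`, where `log(Λ²) = -∑_j c_j log(m_j²)`. -/
theorem M0_well_defined_and_bounds (c m : Fin 3 → ℝ) (Λ : ℝ)
    (hc0 : c 0 = 1) (hm0 : 0 < m 0) (hm01 : m 0 < m 1) (hm12 : m 1 < m 2)
    (hc : ∑ j, c j = 0) (hcm : ∑ j, c j * (m j) ^ 2 = 0)
    (hΛ : 0 < Λ) (hΛdef : Real.log (Λ ^ 2) = -∑ j, c j * Real.log ((m j) ^ 2)) :
    (∀ q : EuclideanSpace ℝ (Fin 3),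
      IntegrableOn (fun u : ℝ =>
        (∑ j, c j * Real.log ((m j) ^ 2 + u * (1 - u) * ‖q‖ ^ 2)) * (u * (1 - u)))
        (Set.Ioo 0 1)) ∧
    (∀ q : EuclideanSpace ℝ (Fin 3), 0 < M0 c m q ∧ M0 c m q ≤ M0 c m 0) ∧
    M0 c m 0 = 2 * Real.log Λ / (3 * π) := by
  have hm : ∀ j, 0 < m j := by
    intro j
    fin_cases j
    exacts [hm0, hm0.trans hm01, (hm0.trans hm01).trans hm12]
  have hI := intervalIntegrable_M0 c hm
  have hπ : -(2 / π) < 0 := neg_lt_zero.2 (by positivity)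
  refine ⟨fun q => ?_, fun q => ⟨?_, ?_⟩, ?_⟩
  · exact ((intervalIntegrable_iff_integrableOn_Ioo_of_le zero_le_one).1 (hI q))
  · rw [M0_eq_intervalIntegral]
    refine mul_pos_of_neg_of_neg hπ ?_
    have h := intervalIntegral.intervalIntegral_pos_of_pos_on (hI q).neg (fun u hu => ?_)
      zero_lt_one
    · simpa [intervalIntegral.integral_neg] using h
    · have h1 : 0 < u * (1 - u) := mul_pos hu.1 (sub_pos.2 hu.2)
      exact neg_pos.2 (mul_neg_of_neg_of_pos
        (sum_mul_log_neg hc0 hm0 hm01 hm12 hc hcm (by positivity)) h1)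
  · rw [M0_eq_intervalIntegral, M0_eq_intervalIntegral]
    refine mul_le_mul_of_nonpos_left ?_ hπ.le
    refine intervalIntegral.integral_mono_on zero_le_one (hI 0) (hI q) fun u hu => ?_
    have h1 : 0 ≤ u * (1 - u) := mul_nonneg hu.1 (sub_nonneg.2 hu.2)
    refine mul_le_mul_of_nonneg_right ?_ h1
    simpa using sum_mul_log_le hc0 hm0 hm01 hm12 hc hcm
      (s := u * (1 - u) * ‖q‖ ^ 2) (by positivity)
  · have hint : ∫ u in (0 : ℝ)..1, u * (1 - u) = 1 / 6 := by
      have h : ∀ u : ℝ, u * (1 - u) = u - u ^ 2 := fun u => by ring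
      simp_rw [h]
      rw [intervalIntegral.integral_sub (continuous_id'.intervalIntegrable 0 1)
        ((continuous_pow 2).intervalIntegrable 0 1), integral_id, integral_pow]
      norm_num
    have hsum : ∑ j, c j * Real.log ((m j) ^ 2) = -(2 * Real.log Λ) := by
      rw [Real.log_pow] at hΛdef
      push_cast at hΛdef
      linarith
    simp_rw [M0_eq_intervalIntegral, norm_zero, zero_pow two_ne_zero, mul_zero, add_zero, hsum]
    rw [intervalIntegral.integral_const_mul, hint]
    field_simp
    ring
end

section
/- Let c₀ = 1, c₁, c₂ be real numbers and 0 < m₀ < m₁ < m₂ satisfy ∑_{j=0}^2 c_j = 0 and ∑_{j=0}^2 c_j m_j² = 0. For β > 0, q ∈ ℝ³ and j = 0,1,2 set X_j(β,u,q) = β√(m_j² + u(1−u)|q|²), and define M^T(q,β) = −(8/π) ∫₀¹ ∫₀^∞ ∑_{j=0}^2 c_j [ 1/(1 + e^{−X_j(β,u,q) cosh t}) + (1/(X_j(β,u,q) cosh t)) ( 2 log 2 − log((e^{X_j(β,u,q) cosh t}+1)(e^{−X_j(β,u,q) cosh t}+1)) ) ] dt · u(1−u) du. Then the integrand is absolutely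 integrable on (0,1)×(0,∞), so M^T is well defined, and |M^T(q,β)| ≤ (32/(3√π)) β^{−1/2} ∑_{j=0}^2 |c_j| m_j^{−1/2} for all q ∈ ℝ³; in particular M^T(·,β) is bounded on ℝ³. -/
open Real MeasureTheory

/-- `X_j(β,u,q) = β √(m_j² + u(1-u)|q|²)`. -/
noncomputable def Xfun (m : Fin 3 → ℝ) (j : Fin 3) (β u : ℝ) (q : EuclideanSpace ℝ (Fin 3)) : ℝ :=
  β * Real.sqrt ((m j) ^ 2 + u * (1 - u) * ‖q‖ ^ 2)

/-- The summand of the thermal dielectric response integrand. -/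
noncomputable def MTterm (c m : Fin 3 → ℝ) (β : ℝ) (q : EuclideanSpace ℝ (Fin 3))
    (u t : ℝ) : ℝ :=
  ∑ j, c j *
    (1 / (1 + Real.exp (-Xfun m j β u q * Real.cosh t)) +
      (1 / (Xfun m j β u q * Real.cosh t)) *
        (2 * Real.log 2 -
          Real.log ((Real.exp (Xfun m j β u q * Real.cosh t) + 1) *
            (Real.exp (-Xfun m j β u q * Real.cosh t) + 1))))

/-- The thermal contribution `M^T` to the dielectric response of Dirac's vacuum:
`M^T(q,β) = -(8/π) ∫₀¹ ∫₀^∞ (∑_j c_j [...]) dt · u(1-u) du`. -/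
noncomputable def MT (c m : Fin 3 → ℝ) (q : EuclideanSpace ℝ (Fin 3)) (β : ℝ) : ℝ :=
  -(8 / π) * ∫ u in Set.Ioo (0 : ℝ) 1,
    (∫ t in Set.Ioi (0 : ℝ), MTterm c m β q u t) * (u * (1 - u))

/-- The function `y ↦ 1/(1+e^{-y}) + (2 log 2 - log((e^y+1)(e^{-y}+1)))/y`, which the integrand of
`M^T` evaluates at `y = X_j cosh t`. -/
noncomputable def thermalKernel (y : ℝ) : ℝ :=
  1 / (1 + exp (-y)) + (1 / y) * (2 * log 2 - log ((exp y + 1) * (exp (-y) + 1)))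

theorem log_exp_add_one_mul_exp_neg_add_one (y : ℝ) :
    log ((exp y + 1) * (exp (-y) + 1)) = y + 2 * log (1 + exp (-y)) := by
  have h : (exp y + 1) * (exp (-y) + 1) = exp y * (1 + exp (-y)) ^ 2 := by
    have h1 : exp y * exp (-y) = 1 := by rw [← exp_add]; simp
    linear_combination (- exp (-y) - 1) * h1
  rw [h, log_mul (exp_ne_zero _) (by positivity), log_exp, log_pow]
  norm_num

theorem two_mul_log_two_le_log_exp_add_one_mul (y : ℝ) :
    2 * log 2 ≤ log ((exp y + 1) * (exp (-y) + 1)) := by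
  have h1 : exp y * exp (-y) = 1 := by rw [← exp_add]; simp
  have h2 : (2 : ℝ) ^ 2 ≤ (exp y + 1) * (exp (-y) + 1) := by
    nlinarith [sq_nonneg (exp y - exp (-y)), exp_pos y, exp_pos (-y)]
  calc 2 * log 2 = log (2 ^ 2) := by rw [log_pow]; norm_num
    _ ≤ _ := log_le_log (by norm_num) h2

theorem one_sub_one_div_one_add_exp_neg_le {y : ℝ} (hy : 0 < y) : 1 - 1 / (1 + exp (-y)) ≤ 1 / y := by
  have h : y * exp (-y) ≤ 1 := by
    have h1 : exp y * exp (-y) = 1 := by rw [← exp_add]; simp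
    nlinarith [add_one_le_exp y, exp_pos (-y)]
  have h3 : 1 - 1 / (1 + exp (-y)) = exp (-y) / (1 + exp (-y)) := by
    field_simp
    ring
  rw [h3, div_le_div_iff₀ (by positivity) hy]
  nlinarith [exp_pos (-y)]

theorem one_div_sub_one_le_thermalKernel {y : ℝ} (hy : 0 < y) :
    1 / (1 + exp (-y)) - 1 ≤ thermalKernel y := by
  have hle : log (1 + exp (-y)) ≤ log 2 := by
    refine log_le_log (by positivity) ?_
    have := exp_le_one_iff.2 (neg_nonpos.2 hy.le)
    linarith
  have h : 0 ≤ (1 / y) * (2 * log 2 - 2 * log (1 + exp (-y))) :=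
    mul_nonneg (by positivity) (by linarith)
  have hy1 : 1 / y * y = 1 := by field_simp
  rw [thermalKernel, log_exp_add_one_mul_exp_neg_add_one]
  linear_combination h + hy1

theorem abs_thermalKernel_le_one {y : ℝ} (hy : 0 < y) : |thermalKernel y| ≤ 1 := by
  rw [abs_le]
  constructor
  · have h : 0 < 1 / (1 + exp (-y)) := by positivity
    linarith [one_div_sub_one_le_thermalKernel hy]
  · have h1 : 1 / (1 + exp (-y)) ≤ 1 := by
      rw [div_le_one (by positivity)]
      linarith [exp_pos (-y)]
    have h2 : (1 / y) * (2 * log 2 - log ((exp y + 1) * (exp (-y) + 1))) ≤ 0 :=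
      mul_nonpos_of_nonneg_of_nonpos (by positivity)
        (by linarith [two_mul_log_two_le_log_exp_add_one_mul y])
    rw [thermalKernel]
    linarith

theorem abs_thermalKernel_le_two_div {y : ℝ} (hy : 0 < y) : |thermalKernel y| ≤ 2 / y := by
  have hpos : 0 < 1 / y := by positivity
  have htwo : 2 / y = 2 * (1 / y) := by ring
  rw [abs_le, htwo]
  constructor
  · linarith [one_div_sub_one_le_thermalKernel hy, one_sub_one_div_one_add_exp_neg_le hy]
  · have h1 : 1 / (1 + exp (-y)) ≤ 1 := by
      rw [div_le_one (by positivity)]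
      linarith [exp_pos (-y)]
    have h2 : 0 ≤ log (1 + exp (-y)) := log_nonneg (by linarith [exp_pos (-y)])
    have h3 : log 2 ≤ 1 := by linarith [log_two_lt_d9]
    have h4 : (1 / y) * (2 * log 2 - 2 * log (1 + exp (-y))) ≤ (1 / y) * 2 := by
      gcongr
      linarith
    have hy1 : 1 / y * y = 1 := by field_simp
    rw [thermalKernel, log_exp_add_one_mul_exp_neg_add_one]
    linear_combination h1 + h4 - hy1

theorem abs_thermalKernel_le_rpow {y : ℝ} (hy : 0 < y) :
    |thermalKernel y| ≤ 2 * y ^ (-(1 : ℝ) / 2) := by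
  have hs : 0 < √y := sqrt_pos.2 hy
  have hsq : √y * √y = y := mul_self_sqrt hy.le
  have hrpow : y ^ (-(1 : ℝ) / 2) = 1 / √y := by
    rw [neg_div, rpow_neg hy.le, ← sqrt_eq_rpow, one_div]
  rw [hrpow]
  rcases le_total y 1 with h | h
  · refine (abs_thermalKernel_le_one hy).trans ?_
    have : √y ≤ 1 := sqrt_le_one.2 h
    rw [mul_one_div, le_div_iff₀ hs]
    linarith
  · refine (abs_thermalKernel_le_two_div hy).trans ?_
    have : 1 ≤ √y := one_le_sqrt.2 h
    rw [mul_one_div, div_le_div_iff₀ hy hs]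
    nlinarith

theorem MTterm_eq_sum_thermalKernel (c m : Fin 3 → ℝ) (β : ℝ) (q : EuclideanSpace ℝ (Fin 3))
    (u t : ℝ) :
    MTterm c m β q u t = ∑ j, c j * thermalKernel (Xfun m j β u q * cosh t) := by
  simp only [MTterm, thermalKernel, neg_mul]

theorem mul_le_Xfun {m : Fin 3 → ℝ} {j : Fin 3} {β u : ℝ} (hβ : 0 < β)
    (hu : u ∈ Set.Ioo (0 : ℝ) 1) (q : EuclideanSpace ℝ (Fin 3)) :
    β * m j ≤ Xfun m j β u q := by
  refine mul_le_mul_of_nonneg_left (le_sqrt_of_sq_le ?_) hβ.le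
  have : 0 ≤ u * (1 - u) * ‖q‖ ^ 2 :=
    mul_nonneg (mul_nonneg hu.1.le (by linarith [hu.2])) (by positivity)
  linarith

theorem abs_thermalKernel_Xfun_le {m : Fin 3 → ℝ} {j : Fin 3} (hm : 0 < m j) {β u : ℝ}
    (hβ : 0 < β) (hu : u ∈ Set.Ioo (0 : ℝ) 1) (q : EuclideanSpace ℝ (Fin 3)) (t : ℝ) :
    |thermalKernel (Xfun m j β u q * cosh t)| ≤
      4 * (β ^ (-(1 : ℝ) / 2) * m j ^ (-(1 : ℝ) / 2)) * exp (-(1 : ℝ) / 2 * t) := by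
  have hcosh : exp t / 2 ≤ cosh t := by
    rw [cosh_eq]
    linarith [exp_pos (-t)]
  have hlow : β * m j * (exp t * (1 / 4)) ≤ Xfun m j β u q * cosh t :=
    mul_le_mul (mul_le_Xfun hβ hu q) (by linarith [exp_pos t]) (by positivity)
      ((by positivity : 0 ≤ β * m j).trans (mul_le_Xfun hβ hu q))
  have hpos : 0 < β * m j * (exp t * (1 / 4)) := by positivity
  have hquarter : (1 / 4 : ℝ) ^ (-(1 : ℝ) / 2) = 2 := by
    rw [show (1 / 4 : ℝ) = 2 ^ (-2 : ℝ) by norm_num [rpow_neg], ← rpow_mul (by norm_num)]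
    norm_num
  calc |thermalKernel (Xfun m j β u q * cosh t)|
      ≤ 2 * (Xfun m j β u q * cosh t) ^ (-(1 : ℝ) / 2) :=
        abs_thermalKernel_le_rpow (hpos.trans_le hlow)
    _ ≤ 2 * (β * m j * (exp t * (1 / 4))) ^ (-(1 : ℝ) / 2) := by
        gcongr 2 * ?_
        exact rpow_le_rpow_of_nonpos hpos hlow (by norm_num)
    _ = _ := by
        rw [mul_rpow (by positivity) (by positivity), mul_rpow hβ.le hm.le,
          mul_rpow (exp_pos t).le (by norm_num), hquarter, ← exp_mul, mul_comm t]
        ring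

theorem abs_MTterm_le {c m : Fin 3 → ℝ} (hm : ∀ j, 0 < m j) {β u : ℝ}
    (hβ : 0 < β) (hu : u ∈ Set.Ioo (0 : ℝ) 1) (q : EuclideanSpace ℝ (Fin 3)) (t : ℝ) :
    |MTterm c m β q u t| ≤
      4 * (β ^ (-(1 : ℝ) / 2) * ∑ j, |c j| * m j ^ (-(1 : ℝ) / 2)) *
        exp (-(1 : ℝ) / 2 * t) := by
  rw [MTterm_eq_sum_thermalKernel]
  refine (Finset.abs_sum_le_sum_abs _ _).trans ?_
  rw [Finset.mul_sum, Finset.mul_sum, Finset.sum_mul]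
  refine Finset.sum_le_sum fun j _ => ?_
  rw [abs_mul]
  refine (mul_le_mul_of_nonneg_left (abs_thermalKernel_Xfun_le (hm j) hβ hu q t)
    (abs_nonneg _)).trans_eq ?_
  ring

theorem measurable_MTterm (c m : Fin 3 → ℝ) (β : ℝ) (q : EuclideanSpace ℝ (Fin 3)) :
    Measurable fun p : ℝ × ℝ => MTterm c m β q p.1 p.2 := by
  unfold MTterm Xfun
  fun_prop

theorem integrableOn_mul_one_sub : IntegrableOn (fun u : ℝ => u * (1 - u)) (Set.Ioo 0 1) :=
  ((by fun_prop : Continuous fun u : ℝ => u * (1 - u)).integrableOn_Icc).mono_set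
    Set.Ioo_subset_Icc_self

theorem setIntegral_mul_one_sub : ∫ u in Set.Ioo (0 : ℝ) 1, u * (1 - u) = 1 / 6 := by
  rw [← integral_Ioc_eq_integral_Ioo, ← intervalIntegral.integral_of_le zero_le_one]
  simp only [mul_sub, mul_one, ← pow_two]
  rw [intervalIntegral.integral_sub (by simp) (by simp), integral_id, integral_pow]
  norm_num

theorem integrableOn_MTterm_mul {c m : Fin 3 → ℝ} (hm : ∀ j, 0 < m j) {β : ℝ} (hβ : 0 < β)
    (q : EuclideanSpace ℝ (Fin 3)) :
    IntegrableOn (fun p : ℝ × ℝ => MTterm c m β q p.1 p.2 * (p.1 * (1 - p.1)))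
      (Set.Ioo (0 : ℝ) 1 ×ˢ Set.Ioi (0 : ℝ)) := by
  have hbound : IntegrableOn (fun p : ℝ × ℝ => p.1 * (1 - p.1) *
      (4 * (β ^ (-(1 : ℝ) / 2) * ∑ j, |c j| * m j ^ (-(1 : ℝ) / 2)) *
        exp (-(1 : ℝ) / 2 * p.2))) (Set.Ioo (0 : ℝ) 1 ×ˢ Set.Ioi (0 : ℝ)) := by
    rw [IntegrableOn, Measure.volume_eq_prod, ← Measure.prod_restrict]
    exact Integrable.mul_prod integrableOn_mul_one_sub
      ((integrableOn_exp_mul_Ioi (by norm_num) 0).const_mul _)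
  refine Integrable.mono' hbound
    ((measurable_MTterm c m β q).mul (by fun_prop)).aestronglyMeasurable ?_
  filter_upwards [ae_restrict_mem (measurableSet_Ioo.prod measurableSet_Ioi)] with p hp
  have hu : 0 ≤ p.1 * (1 - p.1) := mul_nonneg hp.1.1.le (by linarith [hp.1.2])
  rw [norm_eq_abs, abs_mul, abs_of_nonneg hu, mul_comm]
  exact mul_le_mul_of_nonneg_left (abs_MTterm_le hm hβ hp.1 q p.2) hu

theorem abs_setIntegral_MTterm_le {c m : Fin 3 → ℝ} (hm : ∀ j, 0 < m j) {β u : ℝ}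
    (hβ : 0 < β) (hu : u ∈ Set.Ioo (0 : ℝ) 1) (q : EuclideanSpace ℝ (Fin 3)) :
    |∫ t in Set.Ioi (0 : ℝ), MTterm c m β q u t| ≤
      8 * (β ^ (-(1 : ℝ) / 2) * ∑ j, |c j| * m j ^ (-(1 : ℝ) / 2)) := by
  refine (norm_integral_le_of_norm_le
    ((integrableOn_exp_mul_Ioi (by norm_num : -(1 : ℝ) / 2 < 0) 0).const_mul _)
    (ae_of_all _ fun t => (norm_eq_abs _).trans_le (abs_MTterm_le hm hβ hu q t))).trans_eq ?_
  rw [integral_const_mul, integral_exp_mul_Ioi (by norm_num)]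
  norm_num
  ring

theorem abs_MT_le {c m : Fin 3 → ℝ} (hm : ∀ j, 0 < m j) {β : ℝ} (hβ : 0 < β)
    (q : EuclideanSpace ℝ (Fin 3)) :
    |MT c m q β| ≤
      32 / (3 * π) * (β ^ (-(1 : ℝ) / 2) * ∑ j, |c j| * m j ^ (-(1 : ℝ) / 2)) := by
  have h : |∫ u in Set.Ioo (0 : ℝ) 1,
      (∫ t in Set.Ioi (0 : ℝ), MTterm c m β q u t) * (u * (1 - u))| ≤
      8 * (β ^ (-(1 : ℝ) / 2) * ∑ j, |c j| * m j ^ (-(1 : ℝ) / 2)) * (1 / 6) := by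
    rw [← setIntegral_mul_one_sub, ← integral_const_mul, ← norm_eq_abs]
    refine norm_integral_le_of_norm_le (integrableOn_mul_one_sub.const_mul _) ?_
    filter_upwards [ae_restrict_mem measurableSet_Ioo] with u hu
    have hu' : 0 ≤ u * (1 - u) := mul_nonneg hu.1.le (by linarith [hu.2])
    rw [norm_eq_abs, abs_mul, abs_of_nonneg hu']
    exact mul_le_mul_of_nonneg_right (abs_setIntegral_MTterm_le hm hβ hu q) hu'
  have hpi : 0 < 8 / π := by positivity
  rw [MT, abs_mul, abs_neg, abs_of_pos hpi]
  refine (mul_le_mul_of_nonneg_left h hpi.le).trans_eq ?_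
  field_simp
  ring

/-- Under the Pauli-Villars conditions, the integrand defining `M^T` is absolutely
integrable on `(0,1) × (0,∞)`, so `M^T` is well defined, and
`|M^T(q,β)| ≤ (32/(3√π)) β^{-1/2} ∑_j |c_j| m_j^{-1/2}`; in particular `M^T(·,β)`
is bounded on ℝ³. -/
theorem MT_well_defined_and_bounded (c m : Fin 3 → ℝ) (β : ℝ)
    (hc0 : c 0 = 1) (hm0 : 0 < m 0) (hm01 : m 0 < m 1) (hm12 : m 1 < m 2)
    (hc : ∑ j, c j = 0) (hcm : ∑ j, c j * (m j) ^ 2 = 0) (hβ : 0 < β) :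
    (∀ q : EuclideanSpace ℝ (Fin 3),
      IntegrableOn (fun p : ℝ × ℝ => MTterm c m β q p.1 p.2 * (p.1 * (1 - p.1)))
        (Set.Ioo (0 : ℝ) 1 ×ˢ Set.Ioi (0 : ℝ))) ∧
    (∀ q : EuclideanSpace ℝ (Fin 3),
      |MT c m q β| ≤ (32 / (3 * Real.sqrt π)) * β ^ (-(1 : ℝ) / 2) *
        ∑ j, |c j| * (m j) ^ (-(1 : ℝ) / 2)) := by
  have hm : ∀ j, 0 < m j := by
    intro j
    fin_cases j
    exacts [hm0, hm0.trans hm01, (hm0.trans hm01).trans hm12]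
  refine ⟨integrableOn_MTterm_mul hm hβ, fun q => (abs_MT_le hm hβ q).trans ?_⟩
  have hsqrt : √π ≤ π := sqrt_le_iff.2 ⟨pi_pos.le, by nlinarith [pi_gt_three]⟩
  have hsum : 0 ≤ ∑ j, |c j| * m j ^ (-(1 : ℝ) / 2) :=
    Finset.sum_nonneg fun j _ => mul_nonneg (abs_nonneg _) (rpow_nonneg (hm j).le _)
  rw [mul_assoc (32 / (3 * √π))]
  gcongr
end

section
/- For every X > 0 and every t ≥ 0, writing c = cosh t, one has e^{−Xc}(1 + Xc + e^{−Xc}) / (1 + e^{−Xc})² ≤ 4 e^{−(X/2)(1 + t²/2)}. -/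
theorem one_add_sq_div_two_le_cosh (t : ℝ) : 1 + t ^ 2 / 2 ≤ Real.cosh t := by
  have hs : |t| / 2 ≤ Real.sinh (|t| / 2) := Real.self_le_sinh_iff.2 (by positivity)
  have hc : Real.cosh t = 1 + 2 * Real.sinh (|t| / 2) ^ 2 := by
    rw [← Real.cosh_abs t, show |t| = 2 * (|t| / 2) by ring, Real.cosh_two_mul, Real.cosh_sq]
    ring_nf
  have hsq : (|t| / 2) ^ 2 ≤ Real.sinh (|t| / 2) ^ 2 := by gcongr
  rw [div_pow, sq_abs] at hsq
  linarith

theorem exp_neg_mul_div_one_add_exp_neg_sq_le {y : ℝ} (hy : 0 ≤ y) :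
    Real.exp (-y) * (1 + y + Real.exp (-y)) / (1 + Real.exp (-y)) ^ 2
      ≤ 4 * Real.exp (-y / 2) := by
  have hsq : Real.exp (-y) = Real.exp (-y / 2) ^ 2 := by
    rw [← Real.exp_nat_mul]
    congr 1
    push_cast
    ring
  have hlin : Real.exp (-y / 2) * (1 + y / 2) ≤ 1 := by
    calc Real.exp (-y / 2) * (1 + y / 2)
        ≤ Real.exp (-y / 2) * Real.exp (y / 2) := by
          gcongr
          linarith [Real.add_one_le_exp (y / 2)]
      _ = 1 := by rw [← Real.exp_add, neg_div, neg_add_cancel, Real.exp_zero]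
  have hle : Real.exp (-y / 2) ≤ 1 := Real.exp_le_one_iff.2 (by linarith)
  have hpos : 0 < Real.exp (-y / 2) := Real.exp_pos _
  rw [hsq]
  generalize Real.exp (-y / 2) = u at *
  have hcube : u ^ 3 ≤ 1 := pow_le_one₀ hpos.le hle
  have hone : 1 ≤ (1 + u ^ 2) ^ 2 := one_le_pow₀ (by nlinarith)
  rw [div_le_iff₀ (by positivity)]
  calc u ^ 2 * (1 + y + u ^ 2) = u * (2 * (u * (1 + y / 2)) - u + u ^ 3) := by ring
    _ ≤ u * (4 * (1 + u ^ 2) ^ 2) := by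
      gcongr
      linarith
    _ = 4 * u * (1 + u ^ 2) ^ 2 := by ring

/-- Pointwise Gaussian-type bound on the thermal integrand: for `X > 0` and `t ≥ 0`,
writing `c = cosh t`,
`e^{-Xc}(1 + Xc + e^{-Xc})/(1 + e^{-Xc})² ≤ 4 e^{-(X/2)(1 + t²/2)}`. -/
theorem thermal_integrand_gaussian_bound (X t : ℝ) (hX : 0 < X) (ht : 0 ≤ t) :
    Real.exp (-X * Real.cosh t) * (1 + X * Real.cosh t + Real.exp (-X * Real.cosh t)) /
        (1 + Real.exp (-X * Real.cosh t)) ^ 2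
      ≤ 4 * Real.exp (-(X / 2) * (1 + t ^ 2 / 2)) := by
  rw [neg_mul]
  refine (exp_neg_mul_div_one_add_exp_neg_sq_le
    (mul_nonneg hX.le (Real.cosh_pos t).le)).trans ?_
  gcongr
  linarith [mul_le_mul_of_nonneg_left (one_add_sq_div_two_le_cosh t) hX.le]
end

section
/- For all real numbers α > 0, γ > 0 and every real ν, the function x ↦ x^{ν−1} e^{−α/x − γx} is integrable on (0,∞), the function t ↦ e^{−2√(αγ) cosh t} cosh(νt) is integrable on (0,∞), and ∫₀^∞ x^{ν−1} e^{−α/x − γx} dx = 2 (α/γ)^{ν/2} ∫₀^∞ e^{−2√(αγ) cosh t} cosh(νt) dt. -/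
open Real MeasureTheory

/-- Exponential factors are integrable against `exp (-c cosh t)` on the whole line. -/
lemma integrable_exp_neg_mul_cosh_mul_exp {c : ℝ} (hc : 0 < c) (ν : ℝ) :
    Integrable (fun t : ℝ => Real.exp (-c * Real.cosh t) * Real.exp (ν * t)) := by
  refine ((integrable_exp_neg_mul_sq (b := c / 8) (by positivity)).const_mul
    (Real.exp (2 * ν ^ 2 / c))).mono' (by fun_prop) (Filter.Eventually.of_forall fun t => ?_)
  rw [Real.norm_of_nonneg (by positivity), ← Real.exp_add, ← Real.exp_add, Real.exp_le_exp]
  have hcosh : t ^ 2 / 4 ≤ Real.cosh t := by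
    rw [← Real.cosh_abs, Real.cosh_eq, ← sq_abs]
    linarith [Real.quadratic_le_exp_of_nonneg (abs_nonneg t), Real.exp_pos (-|t|), abs_nonneg t]
  have hmul : c * (t ^ 2 / 4) ≤ c * Real.cosh t := by gcongr
  have hsq : 2 * ν ^ 2 / c - ν * t + c / 8 * t ^ 2 = (4 * ν - c * t) ^ 2 / (8 * c) := by
    field_simp
    ring
  have hnn : 0 ≤ (4 * ν - c * t) ^ 2 / (8 * c) := by positivity
  linarith

lemma integrable_exp_neg_mul_cosh_mul_cosh {c : ℝ} (hc : 0 < c) (ν : ℝ) :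
    Integrable (fun t : ℝ => Real.exp (-c * Real.cosh t) * Real.cosh (ν * t)) := by
  refine (((integrable_exp_neg_mul_cosh_mul_exp hc ν).add
    (integrable_exp_neg_mul_cosh_mul_exp hc (-ν))).div_const 2).congr
    (Filter.Eventually.of_forall fun t => ?_)
  simp only [Pi.add_apply, Real.cosh_eq (ν * t), neg_mul ν t]
  ring

/-- Folding the two-sided integral onto the positive half-line. -/
lemma integral_exp_neg_mul_cosh_mul_exp {c : ℝ} (hc : 0 < c) (ν : ℝ) :
    ∫ t : ℝ, Real.exp (-c * Real.cosh t) * Real.exp (ν * t) =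
      2 * ∫ t in Set.Ioi (0 : ℝ), Real.exp (-c * Real.cosh t) * Real.cosh (ν * t) := by
  have hint := integrable_exp_neg_mul_cosh_mul_exp hc
  have hneg := integral_comp_neg_Ioi 0
    (fun t : ℝ => Real.exp (-c * Real.cosh t) * Real.exp (ν * t))
  simp only [Real.cosh_neg, neg_zero, mul_neg, ← neg_mul ν] at hneg
  rw [← intervalIntegral.integral_Iic_add_Ioi (b := 0) (hint ν).integrableOn (hint ν).integrableOn,
    ← integral_const_mul, ← hneg,
    ← integral_add (hint (-ν)).integrableOn (hint ν).integrableOn]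
  congr 1 with t
  rw [Real.cosh_eq (ν * t), neg_mul ν t]
  ring

lemma image_const_mul_exp_univ {k : ℝ} (hk : 0 < k) :
    (fun t : ℝ => k * Real.exp t) '' Set.univ = Set.Ioi 0 := by
  ext x
  simp only [Set.image_univ, Set.mem_range, Set.mem_Ioi]
  refine ⟨?_, fun hx => ⟨Real.log (x / k), ?_⟩⟩
  · rintro ⟨t, rfl⟩
    positivity
  · rw [Real.exp_log (by positivity)]
    field_simp

/-- The substitution `x = √(α / γ) exp t` symmetrizes the exponent `-α / x - γ x`. -/
lemma laplace_integrand_comp_exp {α γ : ℝ} (hα : 0 < α) (hγ : 0 < γ) (ν t : ℝ) :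
    |√(α / γ) * Real.exp t| • ((√(α / γ) * Real.exp t) ^ (ν - 1) *
        Real.exp (-α / (√(α / γ) * Real.exp t) - γ * (√(α / γ) * Real.exp t))) =
      (α / γ) ^ (ν / 2) *
        (Real.exp (-(2 * √(α * γ)) * Real.cosh t) * Real.exp (ν * t)) := by
  have hk : 0 < √(α / γ) := by positivity
  have hx : 0 < √(α / γ) * Real.exp t := by positivity
  have hγk : γ * √(α / γ) = √(α * γ) := by
    rw [eq_comm, Real.sqrt_eq_iff_mul_self_eq_of_pos (by positivity)]
    rw [mul_mul_mul_comm, Real.mul_self_sqrt (by positivity)]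
    field_simp
  have hαk : α / √(α / γ) = √(α * γ) := by
    rw [div_eq_iff hk.ne', ← hγk, mul_assoc, Real.mul_self_sqrt (by positivity)]
    field_simp
  have hexp : -α / (√(α / γ) * Real.exp t) - γ * (√(α / γ) * Real.exp t) =
      -(2 * √(α * γ)) * Real.cosh t := by
    rw [neg_div, ← div_div, hαk, ← mul_assoc, hγk, Real.cosh_eq, Real.exp_neg]
    ring
  have hpow : (√(α / γ) * Real.exp t) * (√(α / γ) * Real.exp t) ^ (ν - 1) =
      (α / γ) ^ (ν / 2) * Real.exp (ν * t) := by
    rw [Real.rpow_sub_one hx.ne', mul_div_cancel₀ _ hx.ne',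
      Real.mul_rpow hk.le (Real.exp_pos t).le, ← Real.exp_mul, Real.sqrt_eq_rpow,
      ← Real.rpow_mul (by positivity), mul_comm t ν]
    congr 2
    ring
  rw [abs_of_pos hx, hexp, smul_eq_mul, ← mul_assoc, hpow]
  ring

/-- Laplace-type integral combined with the Sommerfeld representation of the modified
Bessel function of the second kind: for `α, γ > 0` and `ν ∈ ℝ`,
`∫₀^∞ x^{ν-1} e^{-α/x - γx} dx = 2 (α/γ)^{ν/2} ∫₀^∞ e^{-2√(αγ) cosh t} cosh(νt) dt`,
both integrands being integrable on `(0,∞)`. -/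
theorem laplace_sommerfeld_integral (α γ ν : ℝ) (hα : 0 < α) (hγ : 0 < γ) :
    IntegrableOn (fun x : ℝ => x ^ (ν - 1) * Real.exp (-α / x - γ * x)) (Set.Ioi 0) ∧
    IntegrableOn (fun t : ℝ =>
      Real.exp (-2 * Real.sqrt (α * γ) * Real.cosh t) * Real.cosh (ν * t)) (Set.Ioi 0) ∧
    (∫ x in Set.Ioi (0 : ℝ), x ^ (ν - 1) * Real.exp (-α / x - γ * x))
      = 2 * (α / γ) ^ (ν / 2) *
        ∫ t in Set.Ioi (0 : ℝ),
          Real.exp (-2 * Real.sqrt (α * γ) * Real.cosh t) * Real.cosh (ν * t) := by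
  have hc : 0 < 2 * √(α * γ) := by positivity
  have hk : 0 < √(α / γ) := by positivity
  have hderiv : ∀ t ∈ Set.univ, HasDerivWithinAt (fun t : ℝ => √(α / γ) * Real.exp t)
      (√(α / γ) * Real.exp t) Set.univ t := fun t _ =>
    ((Real.hasDerivAt_exp t).const_mul _).hasDerivWithinAt
  have hinj : Set.InjOn (fun t : ℝ => √(α / γ) * Real.exp t) Set.univ := fun _ _ _ _ h =>
    Real.exp_injective (mul_left_cancel₀ hk.ne' h)
  rw [neg_mul 2 √(α * γ)]
  refine ⟨?_, (integrable_exp_neg_mul_cosh_mul_cosh hc ν).integrableOn, ?_⟩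
  · rw [← image_const_mul_exp_univ hk,
      integrableOn_image_iff_integrableOn_abs_deriv_smul MeasurableSet.univ hderiv hinj]
    simp only [laplace_integrand_comp_exp hα hγ]
    exact ((integrable_exp_neg_mul_cosh_mul_exp hc ν).const_mul _).integrableOn
  · rw [← image_const_mul_exp_univ hk,
      integral_image_eq_integral_abs_deriv_smul MeasurableSet.univ hderiv hinj]
    simp only [laplace_integrand_comp_exp hα hγ, image_const_mul_exp_univ hk]
    rw [setIntegral_univ, integral_const_mul, integral_exp_neg_mul_cosh_mul_exp hc]
    ring
end

section
/- Let c₀ = 1, c₁, c₂ be real numbers and 0 < m₀ < m₁ < m₂ satisfy ∑_{j=0}^2 c_j = 0 and ∑_{j=0}^2 c_j m_j² = 0. For a > 0 define f⁰_PV(a) = (1/(8π²)) ∫₀^∞ ( ∑_{j=0}^2 c_j e^{−s m_j²} ) ( s a coth(s a) − 1 ) s^{−3} ds and f^T_PV(a,β) = (1/(4π²)) ∫₀^∞ ∑_{j=0}^2 c_j e^{−s m_j²} ( s a coth(s a) − 1 ) ∑_{n=1}^∞ (−1)^n e^{−β²n²/(4s)} s^{−3} ds. Then both integrals converge absolutely,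 and for every β > 0 one has (1/(2βπ^{3/2})) ∫₀^β (1/b) ∫₀^∞ s^{−3/2} ( ∑_{j=0}^2 c_j e^{−s m_j²} ) ( s a coth(s a) − 1 ) ( ∑_{k∈ℤ} ω(k,b)² e^{−s ω(k,b)²} ) ds db = f⁰_PV(a) + f^T_PV(a,β), where ω(k,b) = (2k−1)π/b. -/
open Real MeasureTheory

/-- Hyperbolic cotangent. -/
noncomputable def coth (x : ℝ) : ℝ := Real.cosh x / Real.sinh x

/-- Fermionic Matsubara frequencies `ω(k,b) = (2k-1)π/b`. -/
noncomputable def matsubara (k : ℤ) (b : ℝ) : ℝ := (2 * (k : ℝ) - 1) * π / b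

/-- Pauli-Villars-regularised Euler-Heisenberg energy per unit volume at zero temperature:
`f⁰_PV(a) = (1/(8π²)) ∫₀^∞ (∑_j c_j e^{-s m_j²})(s a coth(s a) - 1) s⁻³ ds`. -/
noncomputable def f0PV (c m : Fin 3 → ℝ) (a : ℝ) : ℝ :=
  (1 / (8 * π ^ 2)) * ∫ s in Set.Ioi (0 : ℝ),
    (∑ j, c j * Real.exp (-s * (m j) ^ 2)) * (s * a * coth (s * a) - 1) / s ^ 3

/-- Thermal correction to the Euler-Heisenberg energy per unit volume:
`f^T_PV(a,β) = (1/(4π²)) ∫₀^∞ ∑_j c_j e^{-s m_j²}(s a coth(s a) - 1)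
  (∑_{n=1}^∞ (-1)^n e^{-β²n²/(4s)}) s⁻³ ds`. -/
noncomputable def fTPV (c m : Fin 3 → ℝ) (a β : ℝ) : ℝ :=
  (1 / (4 * π ^ 2)) * ∫ s in Set.Ioi (0 : ℝ),
    (∑ j, c j * Real.exp (-s * (m j) ^ 2)) * (s * a * coth (s * a) - 1) *
      (∑' n : ℕ, (-1 : ℝ) ^ (n + 1) * Real.exp (-β ^ 2 * ((n : ℝ) + 1) ^ 2 / (4 * s))) / s ^ 3

theorem mul_coth_sub_one_abs_le {x : ℝ} (hx : 0 < x) : |x * coth x - 1| ≤ x := by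
  have hs : 0 < Real.sinh x := Real.sinh_pos_iff.2 hx
  have hxs : x ≤ Real.sinh x := Real.self_le_sinh_iff.2 hx.le
  have hsc : Real.sinh x < Real.cosh x := Real.sinh_lt_cosh x
  have hdiff : Real.cosh x - Real.sinh x ≤ 1 := by
    rw [Real.cosh_sub_sinh]
    exact Real.exp_le_one_iff.2 (by linarith)
  have heq : x * coth x - 1 = (x * Real.cosh x - Real.sinh x) / Real.sinh x := by
    unfold coth
    field_simp
  rw [heq, abs_le]
  constructor
  · rw [le_div_iff₀ hs]
    have hder : ∀ y, HasDerivAt (fun y => y * Real.cosh y - Real.sinh y) (y * Real.sinh y) y := by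
      intro y
      have := ((hasDerivAt_id y).mul (Real.hasDerivAt_cosh y)).sub (Real.hasDerivAt_sinh y)
      convert! this using 1
      simp
    have hmono : MonotoneOn (fun y => y * Real.cosh y - Real.sinh y) (Set.Ici 0) := by
      refine monotoneOn_of_deriv_nonneg (convex_Ici 0)
        (fun y _ => (hder y).continuousAt.continuousWithinAt)
        (fun y _ => (hder y).differentiableAt.differentiableWithinAt) fun y hy => ?_
      rw [interior_Ici] at hy
      rw [(hder y).deriv]
      exact mul_nonneg (le_of_lt hy) (Real.sinh_nonneg_iff.2 (le_of_lt hy))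
    have h0 := hmono (Set.self_mem_Ici) (Set.mem_Ici.2 hx.le) hx.le
    simp only [zero_mul, Real.sinh_zero, sub_zero] at h0
    nlinarith
  · rw [div_le_iff₀ hs]
    nlinarith

theorem abs_exp_neg_sub_one_add_le {x : ℝ} (hx : 0 ≤ x) : |Real.exp (-x) - 1 + x| ≤ x ^ 2 := by
  have h1 := Real.add_one_le_exp (-x)
  rw [abs_of_nonneg (by linarith)]
  have h2 := Real.quadratic_le_exp_of_nonneg hx
  have h3 : Real.exp (-x) * Real.exp x = 1 := by rw [← Real.exp_add]; simp
  have h4 := Real.exp_pos (-x)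
  have h5 : Real.exp (-x) * (1 + x + x ^ 2 / 2) ≤ 1 := by nlinarith
  have h6 : 1 ≤ (1 - x + x ^ 2) * (1 + x + x ^ 2 / 2) := by
    nlinarith [pow_nonneg hx 3, pow_nonneg hx 2, pow_nonneg hx 4]
  by_contra! h
  nlinarith [pow_nonneg hx 2]

theorem exists_sum_exp_bound {ι : Type*} [Fintype ι] (c m : ι → ℝ) (hc : ∑ j, c j = 0)
    (hcm : ∑ j, c j * m j ^ 2 = 0) :
    ∃ C, ∀ s, 0 < s → |∑ j, c j * Real.exp (-s * m j ^ 2)| ≤ C * (s ^ 2 / (1 + s ^ 2)) := by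
  have hsmall : ∀ s, 0 < s →
      |∑ j, c j * Real.exp (-s * m j ^ 2)| ≤ (∑ j, |c j| * (m j ^ 2) ^ 2) * s ^ 2 := by
    intro s hs
    have : ∑ j, c j * Real.exp (-s * m j ^ 2)
        = ∑ j, c j * (Real.exp (-(s * m j ^ 2)) - 1 + s * m j ^ 2) := by
      have h : ∀ j, c j * (Real.exp (-(s * m j ^ 2)) - 1 + s * m j ^ 2)
          = c j * Real.exp (-s * m j ^ 2) - c j + s * (c j * m j ^ 2) := by
        intro j; rw [neg_mul]; ring
      simp only [h, Finset.sum_add_distrib, Finset.sum_sub_distrib, ← Finset.mul_sum, hc, hcm]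
      ring
    rw [this, Finset.sum_mul]
    refine (Finset.abs_sum_le_sum_abs _ _).trans (Finset.sum_le_sum fun j _ => ?_)
    rw [abs_mul]
    have := abs_exp_neg_sub_one_add_le (x := s * m j ^ 2) (by positivity)
    calc _ ≤ |c j| * (s * m j ^ 2) ^ 2 := by gcongr
      _ = _ := by ring
  have hlarge : ∀ s, 0 < s → |∑ j, c j * Real.exp (-s * m j ^ 2)| ≤ ∑ j, |c j| := by
    intro s hs
    refine (Finset.abs_sum_le_sum_abs _ _).trans (Finset.sum_le_sum fun j _ => ?_)
    rw [abs_mul, Real.abs_exp]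
    refine mul_le_of_le_one_right (abs_nonneg _) (Real.exp_le_one_iff.2 ?_)
    nlinarith [mul_nonneg hs.le (sq_nonneg (m j))]
  refine ⟨(∑ j, |c j| * (m j ^ 2) ^ 2) + ∑ j, |c j|, fun s hs => ?_⟩
  have h1 := hsmall s hs
  have h2 := hlarge s hs
  rw [← mul_div_assoc, le_div_iff₀ (by positivity)]
  nlinarith [mul_le_mul_of_nonneg_right h2 (sq_nonneg s)]

theorem summable_exp_neg_mul_succ_sq {d : ℝ} (hd : 0 < d) :
    Summable fun n : ℕ => Real.exp (-d * ((n : ℝ) + 1) ^ 2) := by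
  refine Summable.of_nonneg_of_le (fun n => (Real.exp_pos _).le) (fun n => ?_)
    (Real.summable_exp_nat_mul_iff.2 (neg_lt_zero.2 hd))
  refine Real.exp_le_exp.2 ?_
  have : (0 : ℝ) ≤ n := n.cast_nonneg
  nlinarith [mul_nonneg hd.le this, mul_nonneg hd.le (mul_nonneg this this)]

theorem summable_exp_neg_matsubara {s b : ℝ} (hs : 0 < s) (hb : 0 < b) :
    Summable fun k : ℤ => Real.exp (-s * matsubara k b ^ 2) := by
  have hd : 0 < s * (π / b) ^ 2 := by positivity
  have hN : Summable fun n : ℕ => Real.exp (n * -(s * (π / b) ^ 2)) :=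
    Real.summable_exp_nat_mul_iff.2 (neg_lt_zero.2 hd)
  have hZ : Summable fun k : ℤ => Real.exp (|(k : ℝ)| * -(s * (π / b) ^ 2)) := by
    refine Summable.of_nat_of_neg ?_ ?_ <;> simpa using hN
  refine Summable.of_nonneg_of_le (fun n => (Real.exp_pos _).le) (fun k => ?_) hZ
  refine Real.exp_le_exp.2 ?_
  have hk : |(k : ℝ)| ≤ (2 * (k : ℝ) - 1) ^ 2 := by
    have : |k| ≤ (2 * k - 1) ^ 2 := by
      rw [abs_le]
      constructor
      · nlinarith [sq_nonneg k]
      · rcases le_or_gt k 0 with h | h <;> nlinarith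
    exact_mod_cast this
  have : -s * matsubara k b ^ 2 = (2 * (k : ℝ) - 1) ^ 2 * -(s * (π / b) ^ 2) := by
    unfold matsubara; ring
  rw [this]
  nlinarith

theorem summable_sq_mul_exp_neg_matsubara {s b : ℝ} (hs : 0 < s) (hb : 0 < b) :
    Summable fun k : ℤ => matsubara k b ^ 2 * Real.exp (-s * matsubara k b ^ 2) := by
  refine Summable.of_nonneg_of_le (fun k => by positivity) (fun k => ?_)
    ((summable_exp_neg_matsubara (half_pos hs) hb).mul_left (2 / s))
  set w := matsubara k b ^ 2
  have h1 := Real.add_one_le_exp (s / 2 * w)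
  have h2 : Real.exp (-(s / 2) * w) = Real.exp (s / 2 * w) * Real.exp (-s * w) := by
    rw [← Real.exp_add]; ring_nf
  rw [h2, ← mul_assoc]
  refine mul_le_mul_of_nonneg_right ?_ (Real.exp_pos _).le
  rw [div_mul_eq_mul_div, le_div_iff₀ hs]
  linarith

theorem tsum_alternating_mem_Icc {u : ℕ → ℝ} (hu : Antitone u) (hu1 : u 0 ≤ 1)
    (hs : Summable fun n => (-1 : ℝ) ^ n * u n) :
    ∑' n, (-1 : ℝ) ^ n * u n ∈ Set.Icc (0 : ℝ) 1 := by
  have ht := hs.hasSum.tendsto_sum_nat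
  have h1 := hu.alternating_series_le_tendsto ht 0
  have h2 := hu.tendsto_le_alternating_series ht 0
  simp at h1 h2
  exact ⟨h1, h2.trans hu1⟩

theorem abs_tsum_alternating_gaussian_le {β s : ℝ} (hβ : 0 < β) (hs : 0 < s) :
    |∑' n : ℕ, (-1 : ℝ) ^ (n + 1) * Real.exp (-β ^ 2 * ((n : ℝ) + 1) ^ 2 / (4 * s))| ≤ 1 := by
  have hd : 0 < β ^ 2 / (4 * s) := by positivity
  have harg : ∀ n : ℕ, -β ^ 2 * ((n : ℝ) + 1) ^ 2 / (4 * s)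
      = -(β ^ 2 / (4 * s)) * ((n : ℝ) + 1) ^ 2 := fun n => by ring
  simp only [harg]
  generalize β ^ 2 / (4 * s) = d at hd
  have hsum : Summable fun n : ℕ => (-1 : ℝ) ^ n * Real.exp (-d * ((n : ℝ) + 1) ^ 2) := by
    refine Summable.of_norm ?_
    simpa [norm_mul] using summable_exp_neg_mul_succ_sq hd
  have h := tsum_alternating_mem_Icc (u := fun n : ℕ => Real.exp (-d * ((n : ℝ) + 1) ^ 2))
    (fun i j hij => Real.exp_le_exp.2 (by
      have : (i : ℝ) ≤ j := by exact_mod_cast hij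
      have hi : (0 : ℝ) ≤ i := i.cast_nonneg
      have : ((i : ℝ) + 1) ^ 2 ≤ ((j : ℝ) + 1) ^ 2 := by gcongr
      nlinarith))
    (Real.exp_le_one_iff.2 (by simp [hd.le])) hsum
  simp only [pow_succ (-1 : ℝ), mul_neg_one, neg_mul, tsum_neg] at h ⊢
  rw [abs_neg, abs_le]
  exact ⟨by linarith [h.1], h.2⟩

theorem tsum_exp_neg_matsubara {β s : ℝ} (hβ : 0 < β) (hs : 0 < s) :
    ∑' k : ℤ, Real.exp (-s * matsubara k β ^ 2) = β / (2 * √(π * s)) *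
      (1 + 2 * ∑' n : ℕ, (-1 : ℝ) ^ (n + 1) *
        Real.exp (-β ^ 2 * ((n : ℝ) + 1) ^ 2 / (4 * s))) := by
  set r : ℝ := β ^ 2 / (4 * π * s) with hr
  have hr0 : 0 < r := by positivity
  have hsqrt : √r = β / (2 * √(π * s)) := by
    rw [hr, Real.sqrt_div (by positivity), Real.sqrt_sq hβ.le,
      show 4 * π * s = 2 ^ 2 * (π * s) by ring, Real.sqrt_mul (by positivity),
      Real.sqrt_sq (by norm_num)]
  have hP := Complex.tsum_exp_neg_quadratic (a := (r : ℂ)) (by simpa using hr0) (Complex.I / 2)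
  have hL : ∀ n : ℤ, Complex.exp (-π * r * n ^ 2 + 2 * π * (Complex.I / 2) * n)
      = (((-1 : ℝ) ^ n * Real.exp (-β ^ 2 * (n : ℝ) ^ 2 / (4 * s)) : ℝ) : ℂ) := by
    intro n
    rw [Complex.exp_add]
    have h1 : Complex.exp (2 * π * (Complex.I / 2) * n) = (-1) ^ n := by
      rw [← Complex.exp_pi_mul_I, ← Complex.exp_int_mul]
      ring_nf
    rw [h1]
    push_cast
    rw [mul_comm, hr]
    congr 2
    push_cast
    have : (π : ℂ) ≠ 0 := by exact_mod_cast pi_ne_zero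
    have : (s : ℂ) ≠ 0 := by exact_mod_cast hs.ne'
    field_simp
  have hR : ∀ n : ℤ, Complex.exp (-π / r * (n + Complex.I * (Complex.I / 2)) ^ 2)
      = ((Real.exp (-s * matsubara n β ^ 2) : ℝ) : ℂ) := by
    intro n
    rw [Complex.ofReal_exp]
    congr 1
    unfold matsubara
    rw [hr]
    have h2 : (n + Complex.I * (Complex.I / 2) : ℂ) = n - 1 / 2 := by
      linear_combination (1 / 2 : ℂ) * Complex.I_sq
    rw [h2]
    push_cast
    have : (π : ℂ) ≠ 0 := by exact_mod_cast pi_ne_zero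
    have : (s : ℂ) ≠ 0 := by exact_mod_cast hs.ne'
    have : (β : ℂ) ≠ 0 := by exact_mod_cast hβ.ne'
    field_simp
    ring
  simp only [hL, hR] at hP
  rw [show (1 / 2 : ℂ) = ((1 / 2 : ℝ) : ℂ) by push_cast; rfl, ← Complex.ofReal_cpow hr0.le,
    ← Complex.ofReal_tsum, ← Complex.ofReal_tsum] at hP
  have hP' : ∑' n : ℤ, (-1 : ℝ) ^ n * Real.exp (-β ^ 2 * (n : ℝ) ^ 2 / (4 * s))
      = 1 / √r * ∑' n : ℤ, Real.exp (-s * matsubara n β ^ 2) := by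
    rw [Real.sqrt_eq_rpow]
    exact_mod_cast hP
  have hsr : 0 < √r := Real.sqrt_pos.2 hr0
  have hsum : Summable fun n : ℕ =>
      (-1 : ℝ) ^ (n + 1) * Real.exp (-β ^ 2 * ((n : ℝ) + 1) ^ 2 / (4 * s)) := by
    refine Summable.of_norm ?_
    have := summable_exp_neg_mul_succ_sq (d := β ^ 2 / (4 * s)) (by positivity)
    refine this.congr fun n => ?_
    simp only [norm_mul, norm_pow, norm_neg, norm_one, one_pow, one_mul, Real.norm_eq_abs,
      Real.abs_exp]
    congr 1
    ring
  have hsplit : ∑' n : ℤ, (-1 : ℝ) ^ n * Real.exp (-β ^ 2 * (n : ℝ) ^ 2 / (4 * s))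
      = 1 + 2 * ∑' n : ℕ, (-1 : ℝ) ^ (n + 1) *
        Real.exp (-β ^ 2 * ((n : ℝ) + 1) ^ 2 / (4 * s)) := by
    have hpos : ∀ n : ℕ, (-1 : ℝ) ^ ((n : ℤ) + 1)
        * Real.exp (-β ^ 2 * (((n : ℤ) + 1 : ℤ) : ℝ) ^ 2 / (4 * s))
        = (-1 : ℝ) ^ (n + 1) * Real.exp (-β ^ 2 * ((n : ℝ) + 1) ^ 2 / (4 * s)) := by
      intro n
      push_cast
      norm_cast
    have hneg : ∀ n : ℕ, (-1 : ℝ) ^ (-((n : ℤ) + 1))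
        * Real.exp (-β ^ 2 * ((-((n : ℤ) + 1) : ℤ) : ℝ) ^ 2 / (4 * s))
        = (-1 : ℝ) ^ (n + 1) * Real.exp (-β ^ 2 * ((n : ℝ) + 1) ^ 2 / (4 * s)) := by
      intro n
      rw [← hpos, zpow_neg, ← inv_zpow, inv_neg_one]
      push_cast
      rw [neg_sq]
    rw [tsum_of_add_one_of_neg_add_one
      (f := fun n : ℤ => (-1 : ℝ) ^ n * Real.exp (-β ^ 2 * (n : ℝ) ^ 2 / (4 * s)))
      (by simpa only [hpos] using hsum) (by simpa only [hneg] using hsum)]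
    simp only [hpos, hneg]
    simp
    ring
  rw [← hsqrt, ← hsplit, hP']
  field_simp

theorem measurable_matsubara (k : ℤ) : Measurable (matsubara k) := by
  unfold matsubara
  fun_prop

theorem hasDerivAt_exp_neg_matsubara (k : ℤ) {s b : ℝ} (hs : 0 < s) (hb : 0 < b) :
    HasDerivAt (fun b => Real.exp (-s * matsubara k b ^ 2) / (2 * s))
      (1 / b * (matsubara k b ^ 2 * Real.exp (-s * matsubara k b ^ 2))) b := by
  have h1 : HasDerivAt (matsubara k) (-matsubara k b / b) b := by
    have := (hasDerivAt_inv hb.ne').const_mul ((2 * (k : ℝ) - 1) * π)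
    convert! this using 1
    unfold matsubara
    field_simp
  have h2 := (((h1.pow 2).const_mul (-s)).exp).div_const (2 * s)
  convert! h2 using 1
  simp only [Pi.pow_apply]
  field_simp
  push_cast
  ring

theorem tendsto_exp_neg_matsubara (k : ℤ) {s : ℝ} (hs : 0 < s) :
    Filter.Tendsto (fun b => Real.exp (-s * matsubara k b ^ 2) / (2 * s))
      (nhdsWithin 0 (Set.Ioi 0)) (nhds 0) := by
  have hk : (2 * (k : ℝ) - 1) ≠ 0 := by
    have : 2 * k - 1 ≠ 0 := by omega
    exact_mod_cast this
  have hC : 0 < s * ((2 * (k : ℝ) - 1) * π) ^ 2 := by positivity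
  have h1 : Filter.Tendsto (fun b : ℝ => (b⁻¹) ^ 2) (nhdsWithin 0 (Set.Ioi 0)) Filter.atTop :=
    (Filter.tendsto_pow_atTop two_ne_zero).comp tendsto_inv_nhdsGT_zero
  have h2 := (Real.tendsto_exp_neg_atTop_nhds_zero.comp (h1.const_mul_atTop hC)).div_const (2 * s)
  rw [zero_div] at h2
  refine h2.congr fun b => ?_
  simp only [Function.comp, matsubara]
  congr 2
  ring

theorem lintegral_matsubara_term (k : ℤ) {s β : ℝ} (hs : 0 < s) (hβ : 0 < β) :
    ∫⁻ b in Set.Ioo 0 β,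
        ENNReal.ofReal (1 / b * (matsubara k b ^ 2 * Real.exp (-s * matsubara k b ^ 2)))
      = ENNReal.ofReal (Real.exp (-s * matsubara k β ^ 2) / (2 * s)) := by
  set g : ℝ → ℝ := Function.update (fun b => Real.exp (-s * matsubara k b ^ 2) / (2 * s)) 0 0
    with hg
  set g' : ℝ → ℝ := fun b => 1 / b * (matsubara k b ^ 2 * Real.exp (-s * matsubara k b ^ 2))
  have hderiv : ∀ x, 0 < x → HasDerivAt g (g' x) x := fun x hx =>
    (hasDerivAt_exp_neg_matsubara k hs hx).congr_of_eventuallyEq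
      (Filter.eventually_of_mem (isOpen_ne.mem_nhds hx.ne')
        fun y hy => Function.update_of_ne hy _ _)
  have hcont : ContinuousOn g (Set.Icc 0 β) := by
    intro x hx
    rcases hx.1.eq_or_lt with rfl | hx0
    · have : ContinuousWithinAt g (Set.Ici 0) 0 := by
        rw [hg, continuousWithinAt_update_same]
        simpa using tendsto_exp_neg_matsubara k hs
      exact this.mono Set.Icc_subset_Ici_self
    · exact (hderiv x hx0).continuousAt.continuousWithinAt
  have hpos : ∀ x ∈ Set.Ioo 0 β, 0 ≤ g' x := fun x hx => by
    have := hx.1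
    positivity
  have hint := intervalIntegral.integrableOn_deriv_of_nonneg hcont (fun x hx => hderiv x hx.1) hpos
  have hFTC := intervalIntegral.integral_eq_sub_of_hasDerivAt_of_le hβ.le hcont
    (fun x hx => hderiv x hx.1) ((intervalIntegrable_iff_integrableOn_Ioc_of_le hβ.le).2 hint)
  rw [intervalIntegral.integral_of_le hβ.le, integral_Ioc_eq_integral_Ioo] at hFTC
  rw [← ofReal_integral_eq_lintegral_ofReal (hint.mono_set Set.Ioo_subset_Ioc_self)
    (ae_restrict_of_forall_mem measurableSet_Ioo hpos), hFTC, hg,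
    Function.update_of_ne hβ.ne', Function.update_self, sub_zero]

theorem lintegral_matsubara_sum {s β : ℝ} (hs : 0 < s) (hβ : 0 < β) :
    ∫⁻ b in Set.Ioo 0 β, ENNReal.ofReal
        (1 / b * ∑' k : ℤ, matsubara k b ^ 2 * Real.exp (-s * matsubara k b ^ 2))
      = ENNReal.ofReal ((∑' k : ℤ, Real.exp (-s * matsubara k β ^ 2)) / (2 * s)) := by
  have h1 : ∀ b ∈ Set.Ioo 0 β, ENNReal.ofReal
        (1 / b * ∑' k : ℤ, matsubara k b ^ 2 * Real.exp (-s * matsubara k b ^ 2))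
      = ∑' k : ℤ, ENNReal.ofReal
        (1 / b * (matsubara k b ^ 2 * Real.exp (-s * matsubara k b ^ 2))) := fun b hb => by
    have hb0 := hb.1
    rw [← tsum_mul_left, ENNReal.ofReal_tsum_of_nonneg (fun k => by positivity)
      ((summable_sq_mul_exp_neg_matsubara hs hb0).mul_left _)]
  rw [setLIntegral_congr_fun measurableSet_Ioo h1, lintegral_tsum fun k => by
    have := measurable_matsubara k
    exact Measurable.aemeasurable (by fun_prop)]
  simp only [lintegral_matsubara_term _ hs hβ]
  rw [← ENNReal.ofReal_tsum_of_nonneg (fun k => by positivity)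
    ((summable_exp_neg_matsubara hs hβ).div_const _), tsum_div_const]

theorem measurable_matsubara_kernel : Measurable fun p : ℝ × ℝ =>
    1 / p.1 * ∑' k : ℤ, matsubara k p.1 ^ 2 * Real.exp (-p.2 * matsubara k p.1 ^ 2) := by
  refine (measurable_const.div measurable_fst).mul (Measurable.tsum fun k => ?_)
  have : Measurable fun p : ℝ × ℝ => matsubara k p.1 := (measurable_matsubara k).comp measurable_fst
  fun_prop

theorem matsubara_kernel_nonneg {s b : ℝ} (hb : 0 < b) :
    0 ≤ 1 / b * ∑' k : ℤ, matsubara k b ^ 2 * Real.exp (-s * matsubara k b ^ 2) :=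
  mul_nonneg (by positivity) (tsum_nonneg fun k => by positivity)

theorem integrableOn_matsubara_kernel {s β : ℝ} (hs : 0 < s) (hβ : 0 < β) :
    IntegrableOn (fun b =>
      1 / b * ∑' k : ℤ, matsubara k b ^ 2 * Real.exp (-s * matsubara k b ^ 2))
      (Set.Ioo 0 β) := by
  refine ⟨(measurable_matsubara_kernel.comp measurable_prodMk_right).aestronglyMeasurable, ?_⟩
  rw [hasFiniteIntegral_iff_ofReal (ae_restrict_of_forall_mem measurableSet_Ioo
    fun b hb => matsubara_kernel_nonneg hb.1), lintegral_matsubara_sum hs hβ]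
  exact ENNReal.ofReal_lt_top

theorem integral_matsubara_kernel {s β : ℝ} (hs : 0 < s) (hβ : 0 < β) :
    ∫ b in Set.Ioo 0 β, 1 / b * ∑' k : ℤ, matsubara k b ^ 2 * Real.exp (-s * matsubara k b ^ 2)
      = (∑' k : ℤ, Real.exp (-s * matsubara k β ^ 2)) / (2 * s) := by
  rw [integral_eq_lintegral_of_nonneg_ae (ae_restrict_of_forall_mem measurableSet_Ioo
    fun b hb => matsubara_kernel_nonneg hb.1) (integrableOn_matsubara_kernel hs hβ).1,
    lintegral_matsubara_sum hs hβ, ENNReal.toReal_ofReal]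
  exact div_nonneg (tsum_nonneg fun k => (Real.exp_pos _).le) (by positivity)

theorem integral_integral_swap_matsubara {w : ℝ → ℝ} (hw : Measurable w) {β : ℝ} (hβ : 0 < β)
    (hint : IntegrableOn
      (fun s => w s * ((∑' k : ℤ, Real.exp (-s * matsubara k β ^ 2)) / (2 * s))) (Set.Ioi 0)) :
    ∫ b in Set.Ioo 0 β, (1 / b) * ∫ s in Set.Ioi 0,
        w s * ∑' k : ℤ, matsubara k b ^ 2 * Real.exp (-s * matsubara k b ^ 2)
      = ∫ s in Set.Ioi 0, w s * ((∑' k : ℤ, Real.exp (-s * matsubara k β ^ 2)) / (2 * s)) := by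
  set K : ℝ → ℝ → ℝ := fun b s =>
    1 / b * ∑' k : ℤ, matsubara k b ^ 2 * Real.exp (-s * matsubara k b ^ 2)
  have hF : Integrable (Function.uncurry fun b s => w s * K b s)
      ((volume.restrict (Set.Ioo 0 β)).prod (volume.restrict (Set.Ioi 0))) := by
    have hmeas : Measurable (Function.uncurry fun b s => w s * K b s) :=
      (hw.comp measurable_snd).mul measurable_matsubara_kernel
    rw [integrable_prod_iff' hmeas.aestronglyMeasurable]
    refine ⟨ae_restrict_of_forall_mem measurableSet_Ioi fun s hs =>
      (integrableOn_matsubara_kernel hs hβ).const_mul (w s), hint.norm.congr ?_⟩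
    refine ae_restrict_of_forall_mem measurableSet_Ioi fun s hs => ?_
    have hK : ∫ b in Set.Ioo 0 β, ‖K b s‖ = ∫ b in Set.Ioo 0 β, K b s :=
      setIntegral_congr_fun measurableSet_Ioo fun b hb =>
        Real.norm_of_nonneg (matsubara_kernel_nonneg hb.1)
    have hnn : 0 ≤ (∑' k : ℤ, Real.exp (-s * matsubara k β ^ 2)) / (2 * s) :=
      div_nonneg (tsum_nonneg fun k => (Real.exp_pos _).le) (by
        have : (0 : ℝ) < s := hs
        positivity)
    simp only [Function.uncurry, norm_mul, Real.norm_of_nonneg hnn]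
    rw [integral_const_mul, hK, integral_matsubara_kernel hs hβ]
  have hL : ∀ b : ℝ, (1 / b) * ∫ s in Set.Ioi 0,
        w s * ∑' k : ℤ, matsubara k b ^ 2 * Real.exp (-s * matsubara k b ^ 2)
      = ∫ s in Set.Ioi 0, w s * K b s := fun b => by
    rw [← integral_const_mul]
    congr 1
    funext s
    ring
  simp only [hL]
  rw [integral_integral_swap hF]
  refine setIntegral_congr_fun measurableSet_Ioi fun s hs => ?_
  simp only [integral_const_mul]
  rw [integral_matsubara_kernel hs hβ]

theorem measurable_coth : Measurable coth := by
  unfold coth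
  exact Real.measurable_cosh.div Real.measurable_sinh

theorem integrableOn_pauliVillars {ι : Type*} [Fintype ι] (c m : ι → ℝ) (hc : ∑ j, c j = 0)
    (hcm : ∑ j, c j * m j ^ 2 = 0) {a : ℝ} (ha : 0 < a) :
    IntegrableOn (fun s : ℝ =>
      (∑ j, c j * Real.exp (-s * m j ^ 2)) * (s * a * coth (s * a) - 1) / s ^ 3)
      (Set.Ioi 0) := by
  obtain ⟨C, hC⟩ := exists_sum_exp_bound c m hc hcm
  have hdom : IntegrableOn (fun s : ℝ => C * a * (1 + s ^ 2)⁻¹) (Set.Ioi 0) :=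
    (integrable_inv_one_add_sq.const_mul _).integrableOn
  refine hdom.mono' ?_ (ae_restrict_of_forall_mem measurableSet_Ioi fun s hs => ?_)
  · have := measurable_coth
    exact Measurable.aestronglyMeasurable (by fun_prop)
  · have hs : (0 : ℝ) < s := hs
    have h1 := hC s hs
    have h2 := mul_coth_sub_one_abs_le (mul_pos hs ha)
    rw [norm_div, norm_mul, Real.norm_eq_abs, Real.norm_eq_abs,
      Real.norm_of_nonneg (by positivity : 0 ≤ s ^ 3), div_le_iff₀ (by positivity)]
    calc _ ≤ C * (s ^ 2 / (1 + s ^ 2)) * (s * a) :=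
          mul_le_mul h1 h2 (abs_nonneg _) ((abs_nonneg _).trans h1)
      _ = _ := by field_simp

theorem integrableOn_mul_alternating_gaussian {h : ℝ → ℝ} (hh : IntegrableOn h (Set.Ioi 0))
    {β : ℝ} (hβ : 0 < β) :
    IntegrableOn (fun s => h s * ∑' n : ℕ, (-1 : ℝ) ^ (n + 1) *
      Real.exp (-β ^ 2 * ((n : ℝ) + 1) ^ 2 / (4 * s))) (Set.Ioi 0) := by
  refine hh.mul_bdd (c := 1)
    (Measurable.aestronglyMeasurable (Measurable.tsum fun n => by fun_prop)) ?_
  exact ae_restrict_of_forall_mem measurableSet_Ioi fun s hs =>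
    abs_tsum_alternating_gaussian_le hβ hs

theorem rpow_mul_tsum_exp_neg_matsubara {β s : ℝ} (hβ : 0 < β) (hs : 0 < s) :
    s ^ (-(3 : ℝ) / 2) * ((∑' k : ℤ, Real.exp (-s * matsubara k β ^ 2)) / (2 * s))
      = β / (4 * √π) * ((1 + 2 * ∑' n : ℕ, (-1 : ℝ) ^ (n + 1) *
        Real.exp (-β ^ 2 * ((n : ℝ) + 1) ^ 2 / (4 * s))) / s ^ 3) := by
  have h1 : s ^ (-(3 : ℝ) / 2) = (s * √s)⁻¹ := by
    rw [show -(3 : ℝ) / 2 = -(1 + 1 / 2) by norm_num, Real.rpow_neg hs.le, Real.rpow_add hs,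
      Real.rpow_one, Real.sqrt_eq_rpow]
  have h2 : √s ^ 2 = s := Real.sq_sqrt hs.le
  have h3 : 0 < √s := Real.sqrt_pos.2 hs
  have h4 : 0 < √π := Real.sqrt_pos.2 pi_pos
  rw [tsum_exp_neg_matsubara hβ hs, h1, Real.sqrt_mul pi_pos.le]
  field_simp
  rw [h2]
  ring

/-- Derivation of the thermal Euler-Heisenberg formula: under the Pauli-Villars conditions,
for every `a > 0` and `β > 0`, the integrals defining `f⁰_PV(a)` and `f^T_PV(a,β)` converge
absolutely and
`(1/(2βπ^{3/2})) ∫₀^β (1/b) ∫₀^∞ s^{-3/2} (∑_j c_j e^{-s m_j²})(s a coth(s a) - 1)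
  (∑_{k∈ℤ} ω(k,b)² e^{-s ω(k,b)²}) ds db = f⁰_PV(a) + f^T_PV(a,β)`,
where `ω(k,b) = (2k-1)π/b`. -/
theorem thermal_euler_heisenberg (c m : Fin 3 → ℝ) (a β : ℝ)
    (hc0 : c 0 = 1) (hm0 : 0 < m 0) (hm01 : m 0 < m 1) (hm12 : m 1 < m 2)
    (hc : ∑ j, c j = 0) (hcm : ∑ j, c j * (m j) ^ 2 = 0)
    (ha : 0 < a) (hβ : 0 < β) :
    IntegrableOn (fun s : ℝ =>
      (∑ j, c j * Real.exp (-s * (m j) ^ 2)) * (s * a * coth (s * a) - 1) / s ^ 3)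
      (Set.Ioi 0) ∧
    IntegrableOn (fun s : ℝ =>
      (∑ j, c j * Real.exp (-s * (m j) ^ 2)) * (s * a * coth (s * a) - 1) *
        (∑' n : ℕ, (-1 : ℝ) ^ (n + 1) * Real.exp (-β ^ 2 * ((n : ℝ) + 1) ^ 2 / (4 * s))) / s ^ 3)
      (Set.Ioi 0) ∧
    (1 / (2 * β * π ^ ((3 : ℝ) / 2))) * (∫ b in Set.Ioo (0 : ℝ) β, (1 / b) *
        ∫ s in Set.Ioi (0 : ℝ), s ^ (-(3 : ℝ) / 2) *
          (∑ j, c j * Real.exp (-s * (m j) ^ 2)) * (s * a * coth (s * a) - 1) *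
          (∑' k : ℤ, matsubara k b ^ 2 * Real.exp (-s * matsubara k b ^ 2)))
      = f0PV c m a + fTPV c m a β := by
  have hf0 := integrableOn_pauliVillars c m hc hcm ha
  have hfT := integrableOn_mul_alternating_gaussian hf0 hβ
  have hrearr : ∀ x y z : ℝ, x / z * y = x * y / z := fun x y z => by ring
  refine ⟨hf0, by simpa only [hrearr] using hfT, ?_⟩
  set A : ℝ → ℝ := fun s => ∑' n : ℕ, (-1 : ℝ) ^ (n + 1) *
    Real.exp (-β ^ 2 * ((n : ℝ) + 1) ^ 2 / (4 * s)) with hA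
  set h : ℝ → ℝ := fun s =>
    (∑ j, c j * Real.exp (-s * m j ^ 2)) * (s * a * coth (s * a) - 1) / s ^ 3 with hh
  set w : ℝ → ℝ := fun s => s ^ (-(3 : ℝ) / 2) *
    (∑ j, c j * Real.exp (-s * m j ^ 2)) * (s * a * coth (s * a) - 1) with hw
  have hpoint : ∀ s ∈ Set.Ioi (0 : ℝ),
      w s * ((∑' k : ℤ, Real.exp (-s * matsubara k β ^ 2)) / (2 * s))
        = β / (4 * √π) * (h s + 2 * (h s * A s)) := fun s hs => by
    have := rpow_mul_tsum_exp_neg_matsubara hβ hs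
    simp only [hw, hh, hA]
    linear_combination
      (∑ j, c j * Real.exp (-s * m j ^ 2)) * (s * a * coth (s * a) - 1) * this
  have hint : IntegrableOn (fun s => β / (4 * √π) * (h s + 2 * (h s * A s))) (Set.Ioi 0) :=
    (hf0.add (hfT.const_mul 2)).const_mul _
  have hwm : Measurable w := by
    have := measurable_coth
    fun_prop
  rw [integral_integral_swap_matsubara hwm hβ
    (hint.congr_fun (fun s hs => (hpoint s hs).symm) measurableSet_Ioi),
    setIntegral_congr_fun measurableSet_Ioi hpoint, integral_const_mul,
    integral_add hf0 (hfT.const_mul 2), integral_const_mul]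
  have hf0_eq : f0PV c m a = 1 / (8 * π ^ 2) * ∫ s in Set.Ioi (0 : ℝ), h s := rfl
  have hfT_eq : fTPV c m a β = 1 / (4 * π ^ 2) * ∫ s in Set.Ioi (0 : ℝ), h s * A s := by
    simp only [fTPV, hh, hA, hrearr]
  have hpi : π ^ ((3 : ℝ) / 2) = π * √π := by
    rw [show (3 : ℝ) / 2 = 1 + 1 / 2 by norm_num, Real.rpow_add pi_pos, Real.rpow_one,
      Real.sqrt_eq_rpow]
  have hsq : √π ^ 2 = π := Real.sq_sqrt pi_pos.le
  have hsq0 : 0 < √π := Real.sqrt_pos.2 pi_pos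
  rw [hf0_eq, hfT_eq, hpi]
  generalize (∫ s in Set.Ioi (0 : ℝ), h s) = I₀, (∫ s in Set.Ioi (0 : ℝ), h s * A s) = I₁
  field_simp
  rw [hsq]
  ring
end

section
/- Let c₀ = 1, c₁, c₂ be real numbers and 0 < m₀ < m₁ < m₂ satisfy ∑_{j=0}^2 c_j = 0 and ∑_{j=0}^2 c_j m_j² = 0, and for a > 0 let g(s) = s^{−3/2} ( ∑_{j=0}^2 c_j e^{−s m_j²} ) ( s a coth(s a) − 1 ). Then ∫₀^∞ g'(s) s^{−1/2} ds = (1/2) ∫₀^∞ ( ∑_{j=0}^2 c_j e^{−s m_j²} ) ( s a coth(s a) − 1 ) s^{−3} ds, both integrals being absolutely convergent; equivalently, (1/(4π²)) ∫₀^∞ (d/ds)[ s^{−3/2} ( ∑_j c_j e^{−s m_j²} )( s a coth(s a) − 1 ) ] s^{−1/2} ds = f⁰_PV(a) with f⁰_PV(a) = (1/(8π²)) ∫₀^∞ ( ∑_j c_j e^{−s m_j²} )( s a coth(s a) − 1 ) s^{−3} ds. -/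
open Real MeasureTheory

/-- `g(s) = s^{-3/2} (∑_j c_j e^{-s m_j²})(s a coth(s a) - 1)`. -/
noncomputable def gEH (c m : Fin 3 → ℝ) (a s : ℝ) : ℝ :=
  s ^ (-(3 : ℝ) / 2) * (∑ j, c j * Real.exp (-s * (m j) ^ 2)) * (s * a * coth (s * a) - 1)

open Set Filter Topology

theorem sinh_le_mul_cosh {x : ℝ} (hx : 0 ≤ x) : sinh x ≤ x * cosh x := by
  have hd : ∀ y : ℝ, HasDerivAt (fun y => y * cosh y - sinh y) (y * sinh y) y := fun y => by
    refine (((hasDerivAt_id y).mul (hasDerivAt_cosh y)).sub (hasDerivAt_sinh y)).congr_deriv ?_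
    simp
  have hmono : MonotoneOn (fun y => y * cosh y - sinh y) (Ici 0) :=
    monotoneOn_of_hasDerivWithinAt_nonneg (convex_Ici 0)
      (fun y _ => (hd y).continuousAt.continuousWithinAt)
      (fun y _ => (hd y).hasDerivWithinAt) fun y hy => by
        rw [interior_Ici] at hy
        exact mul_nonneg hy.le (sinh_nonneg_iff.2 hy.le)
  simpa using hmono self_mem_Ici hx hx

theorem mul_cosh_sub_sinh_le {x : ℝ} (hx : 0 ≤ x) : x * cosh x - sinh x ≤ x ^ 2 * sinh x := by
  have h1 : x ≤ sinh x := self_le_sinh_iff.2 hx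
  have h2 : cosh x - 1 ≤ x * sinh x := by
    obtain ⟨y, rfl⟩ : ∃ y, x = 2 * y := ⟨x / 2, by ring⟩
    have hy : 0 ≤ y := by linarith
    have hs : 0 ≤ sinh y := sinh_nonneg_iff.2 hy
    rw [cosh_two_mul, sinh_two_mul, cosh_sq]
    nlinarith [mul_le_mul_of_nonneg_left (sinh_le_mul_cosh hy) hs,
      mul_nonneg (mul_nonneg hy hs) (cosh_pos y).le]
  nlinarith

theorem mul_coth_sub_one_nonneg {x : ℝ} (hx : 0 < x) : 0 ≤ x * coth x - 1 := by
  have hs : 0 < sinh x := sinh_pos_iff.2 hx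
  rw [coth, ← mul_div_assoc, sub_nonneg, le_div_iff₀ hs, one_mul]
  exact sinh_le_mul_cosh hx.le

theorem mul_coth_sub_one_le {x : ℝ} (hx : 0 < x) : x * coth x - 1 ≤ x ^ 2 := by
  have hs : 0 < sinh x := sinh_pos_iff.2 hx
  rw [coth, ← mul_div_assoc, sub_le_iff_le_add, div_le_iff₀ hs]
  linarith [mul_cosh_sub_sinh_le hx.le]

theorem hasDerivAt_mul_coth {x : ℝ} (hx : 0 < x) :
    HasDerivAt (fun x => x * coth x) ((cosh x * sinh x - x) / sinh x ^ 2) x := by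
  have hs : sinh x ≠ 0 := (sinh_pos_iff.2 hx).ne'
  refine ((hasDerivAt_id x).mul
    ((hasDerivAt_cosh x).div (hasDerivAt_sinh x) hs)).congr_deriv ?_
  simp only [id, Pi.div_apply]
  field_simp
  linear_combination (-x) * cosh_sq x

theorem abs_deriv_mul_coth_le {x : ℝ} (hx : 0 < x) :
    |(cosh x * sinh x - x) / sinh x ^ 2| ≤ x := by
  have hs : 0 < sinh x := sinh_pos_iff.2 hx
  have h1 : x ≤ sinh x := self_le_sinh_iff.2 hx.le
  rw [abs_of_nonneg (div_nonneg (by nlinarith [one_le_cosh x]) (sq_nonneg _)),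
    div_le_iff₀ (by positivity)]
  nlinarith [mul_le_mul_of_nonneg_right (sinh_le_mul_cosh hx.le) (cosh_pos x).le, cosh_sq x]

theorem abs_exp_neg_sub_one_le {t : ℝ} (ht : 0 ≤ t) : |exp (-t) - 1| ≤ t := by
  rw [abs_le]
  constructor <;> linarith [one_sub_le_exp_neg t, exp_le_one_iff.2 (neg_nonpos.2 ht)]

theorem abs_exp_neg_sub_one_add_le_s17 {t : ℝ} (ht : 0 ≤ t) : |exp (-t) - 1 + t| ≤ t ^ 2 := by
  rw [abs_of_nonneg (by linarith [one_sub_le_exp_neg t])]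
  have h : exp (-t) * (1 + t) ≤ 1 := by
    calc exp (-t) * (1 + t) ≤ exp (-t) * exp t := by
          gcongr
          linarith [add_one_le_exp t]
      _ = 1 := by rw [← exp_add]; simp
  by_contra! hlt
  nlinarith [pow_nonneg ht 3]

section ExponentialSums

variable {ι : Type*} [Fintype ι] {c μ : ι → ℝ} {b : ℝ}

theorem sum_mul_exp_eq (c μ : ι → ℝ) (b s : ℝ) :
    ∑ j, c j * exp (-s * μ j) = exp (-b * s) * ∑ j, c j * exp (-(s * (μ j - b))) := by
  rw [Finset.mul_sum]
  refine Finset.sum_congr rfl fun j _ => ?_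
  rw [mul_left_comm, ← exp_add]
  ring_nf

theorem abs_sum_mul_exp_le (hc : ∑ j, c j = 0) (hb : ∀ j, b ≤ μ j) {s : ℝ} (hs : 0 ≤ s) :
    |∑ j, c j * exp (-s * μ j)| ≤ (∑ j, |c j| * (μ j - b)) * s * exp (-b * s) := by
  have key : ∑ j, c j * exp (-(s * (μ j - b))) =
      ∑ j, c j * (exp (-(s * (μ j - b))) - 1) := by
    simp only [mul_sub, Finset.sum_sub_distrib, mul_one, hc, sub_zero]
  rw [sum_mul_exp_eq c μ b, key, abs_mul, abs_of_pos (exp_pos _), mul_comm]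
  gcongr
  rw [Finset.sum_mul]
  refine (Finset.abs_sum_le_sum_abs _ _).trans (Finset.sum_le_sum fun j _ => ?_)
  rw [abs_mul, mul_assoc, mul_comm _ s]
  gcongr
  exact abs_exp_neg_sub_one_le (mul_nonneg hs (sub_nonneg.2 (hb j)))

theorem abs_sum_mul_exp_le_sq (hc : ∑ j, c j = 0) (hcμ : ∑ j, c j * μ j = 0)
    (hb : ∀ j, b ≤ μ j) {s : ℝ} (hs : 0 ≤ s) :
    |∑ j, c j * exp (-s * μ j)| ≤ (∑ j, |c j| * (μ j - b) ^ 2) * s ^ 2 * exp (-b * s) := by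
  have key : ∑ j, c j * exp (-(s * (μ j - b))) =
      ∑ j, c j * (exp (-(s * (μ j - b))) - 1 + s * (μ j - b)) := by
    have h : ∀ j, c j * (exp (-(s * (μ j - b))) - 1 + s * (μ j - b)) =
        c j * exp (-(s * (μ j - b))) - c j * (1 + s * b) + s * (c j * μ j) := fun j => by ring
    simp only [h, Finset.sum_add_distrib, Finset.sum_sub_distrib, ← Finset.mul_sum,
      ← Finset.sum_mul, hc, hcμ]
    ring
  rw [sum_mul_exp_eq c μ b, key, abs_mul, abs_of_pos (exp_pos _), mul_comm]
  gcongr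
  rw [Finset.sum_mul]
  refine (Finset.abs_sum_le_sum_abs _ _).trans (Finset.sum_le_sum fun j _ => ?_)
  rw [abs_mul, mul_assoc, ← mul_pow, mul_comm _ s]
  gcongr
  exact abs_exp_neg_sub_one_add_le_s17 (mul_nonneg hs (sub_nonneg.2 (hb j)))

theorem hasDerivAt_sum_mul_exp (c μ : ι → ℝ) (s : ℝ) :
    HasDerivAt (fun s => ∑ j, c j * exp (-s * μ j)) (-∑ j, c j * μ j * exp (-s * μ j)) s := by
  rw [← Finset.sum_neg_distrib]
  refine HasDerivAt.fun_sum fun j _ => ?_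
  refine ((((hasDerivAt_id s).neg.mul_const (μ j)).exp).const_mul (c j)).congr_deriv ?_
  simp
  ring

end ExponentialSums

theorem integrableOn_mul_exp_neg_mul (K : ℝ) {b : ℝ} (hb : 0 < b) :
    IntegrableOn (fun s : ℝ => K * s * exp (-b * s)) (Ioi 0) := by
  have h := (integrableOn_rpow_mul_exp_neg_mul_rpow (p := 1) (s := 1) (b := b)
    (by norm_num) one_pos hb).const_mul K
  simpa only [rpow_one, mul_assoc, IntegrableOn] using h

theorem integrableOn_of_abs_le_mul_exp {f : ℝ → ℝ} {K b : ℝ} (hb : 0 < b)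
    (hf : AEStronglyMeasurable f (volume.restrict (Ioi 0)))
    (hle : ∀ s, 0 < s → |f s| ≤ K * s * exp (-b * s)) : IntegrableOn f (Ioi 0) :=
  (integrableOn_mul_exp_neg_mul K hb).mono' hf
    ((ae_restrict_iff' measurableSet_Ioi).2 (ae_of_all _ hle))

theorem abs_mul_div_le {x y A B p : ℝ} (hx : |x| ≤ A) (hy : |y| ≤ B) (hp : 0 < p) :
    |x * y / p| ≤ A * B / p := by
  rw [abs_div, abs_mul, abs_of_pos hp]
  have hA : 0 ≤ A := (abs_nonneg x).trans hx
  gcongr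

theorem abs_mul_coth_sub_one_le {x : ℝ} (hx : 0 < x) : |x * coth x - 1| ≤ x ^ 2 := by
  rw [abs_of_nonneg (mul_coth_sub_one_nonneg hx)]
  exact mul_coth_sub_one_le hx

section Regularised

variable {c m : Fin 3 → ℝ} {a : ℝ}

/-- The derivative of `gEH c m a` at `s > 0`. -/
noncomputable def gEHDeriv (c m : Fin 3 → ℝ) (a s : ℝ) : ℝ :=
  (-(3 : ℝ) / 2 * s ^ (-(5 : ℝ) / 2) * (∑ j, c j * exp (-s * (m j) ^ 2)) +
    s ^ (-(3 : ℝ) / 2) * (-∑ j, c j * (m j) ^ 2 * exp (-s * (m j) ^ 2))) *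
      (s * a * coth (s * a) - 1) +
    s ^ (-(3 : ℝ) / 2) * (∑ j, c j * exp (-s * (m j) ^ 2)) *
      ((cosh (s * a) * sinh (s * a) - s * a) / sinh (s * a) ^ 2 * a)

theorem hasDerivAt_gEH (c m : Fin 3 → ℝ) (ha : 0 < a) {s : ℝ} (hs : 0 < s) :
    HasDerivAt (gEH c m a) (gEHDeriv c m a s) s := by
  have h1 := hasDerivAt_rpow_const (x := s) (p := -(3 : ℝ) / 2) (Or.inl hs.ne')
  have h2 := hasDerivAt_sum_mul_exp c (fun j => (m j) ^ 2) s
  have h3 : HasDerivAt (fun s => s * a * coth (s * a) - 1)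
      ((cosh (s * a) * sinh (s * a) - s * a) / sinh (s * a) ^ 2 * a) s :=
    (HasDerivAt.comp (h := fun s => s * a) (h₂ := fun x => x * coth x) s
      (hasDerivAt_mul_coth (mul_pos hs ha)) (hasDerivAt_mul_const a)).sub_const 1
  refine ((h1.mul h2).mul h3).congr_deriv ?_
  rw [gEHDeriv, show -(5 : ℝ) / 2 = -(3 : ℝ) / 2 - 1 by norm_num]
  rfl

theorem gEHDeriv_mul_rpow (c m : Fin 3 → ℝ) (a : ℝ) {s : ℝ} (hs : 0 < s) :
    gEHDeriv c m a s * s ^ (-(1 : ℝ) / 2) =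
      -(3 / 2) * ((∑ j, c j * exp (-s * (m j) ^ 2)) * (s * a * coth (s * a) - 1) / s ^ 3) -
      (∑ j, c j * (m j) ^ 2 * exp (-s * (m j) ^ 2)) * (s * a * coth (s * a) - 1) / s ^ 2 +
      (∑ j, c j * exp (-s * (m j) ^ 2)) *
        ((cosh (s * a) * sinh (s * a) - s * a) / sinh (s * a) ^ 2 * a) / s ^ 2 := by
  have e1 : s ^ (-(5 : ℝ) / 2) * s ^ (-(1 : ℝ) / 2) = (s ^ 3)⁻¹ := by
    rw [← rpow_add hs, ← rpow_natCast, ← rpow_neg hs.le]; norm_num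
  have e2 : s ^ (-(3 : ℝ) / 2) * s ^ (-(1 : ℝ) / 2) = (s ^ 2)⁻¹ := by
    rw [← rpow_add hs, ← rpow_natCast, ← rpow_neg hs.le]; norm_num
  simp only [div_eq_mul_inv _ (s ^ 3), div_eq_mul_inv _ (s ^ 2), ← e1, ← e2, gEHDeriv]
  ring

theorem rpow_mul_gEH (c m : Fin 3 → ℝ) (a : ℝ) {s : ℝ} (hs : 0 < s) :
    s ^ (-(1 : ℝ) / 2) * gEH c m a s =
      (∑ j, c j * exp (-s * (m j) ^ 2)) * (s * a * coth (s * a) - 1) / s ^ 2 := by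
  have e2 : s ^ (-(3 : ℝ) / 2) * s ^ (-(1 : ℝ) / 2) = (s ^ 2)⁻¹ := by
    rw [← rpow_add hs, ← rpow_natCast, ← rpow_neg hs.le]; norm_num
  rw [div_eq_mul_inv _ (s ^ 2), ← e2, gEH]
  ring

theorem rpow_deriv_mul_gEH (c m : Fin 3 → ℝ) (a : ℝ) {s : ℝ} (hs : 0 < s) :
    -(1 : ℝ) / 2 * s ^ (-(3 : ℝ) / 2) * gEH c m a s =
      -(1 / 2) *
        ((∑ j, c j * exp (-s * (m j) ^ 2)) * (s * a * coth (s * a) - 1) / s ^ 3) := by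
  have e3 : s ^ (-(3 : ℝ) / 2) * s ^ (-(3 : ℝ) / 2) = (s ^ 3)⁻¹ := by
    rw [← rpow_add hs, ← rpow_natCast, ← rpow_neg hs.le]; norm_num
  rw [div_eq_mul_inv _ (s ^ 3), ← e3, gEH]
  ring

theorem continuousOn_integrand (c m : Fin 3 → ℝ) (ha : 0 < a) :
    ContinuousOn (fun s : ℝ =>
      (∑ j, c j * exp (-s * (m j) ^ 2)) * (s * a * coth (s * a) - 1) / s ^ 3) (Ioi 0) := by
  intro s (hs : 0 < s)
  have h : ContinuousAt (fun s => s * a * coth (s * a)) s :=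
    ContinuousAt.comp (f := fun s => s * a) (g := fun x => x * coth x)
      (hasDerivAt_mul_coth (mul_pos hs ha)).continuousAt (by fun_prop)
  refine ContinuousAt.continuousWithinAt (ContinuousAt.div ?_ (by fun_prop) (by positivity))
  exact ContinuousAt.mul (by fun_prop) (h.sub continuousAt_const)

theorem integrableOn_integrand {K b : ℝ} (ha : 0 < a) (hb : 0 < b)
    (hS : ∀ s, 0 < s → |∑ j, c j * exp (-s * (m j) ^ 2)| ≤ K * s ^ 2 * exp (-b * s)) :
    IntegrableOn (fun s : ℝ =>
      (∑ j, c j * exp (-s * (m j) ^ 2)) * (s * a * coth (s * a) - 1) / s ^ 3) (Ioi 0) := by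
  refine integrableOn_of_abs_le_mul_exp (K := K * a ^ 2) hb
    ((continuousOn_integrand c m ha).aestronglyMeasurable measurableSet_Ioi) fun s hs => ?_
  refine (abs_mul_div_le (hS s hs) (abs_mul_coth_sub_one_le (mul_pos hs ha))
    (by positivity)).trans_eq ?_
  field_simp

theorem integrableOn_deriv_gEH_mul_rpow {K L b : ℝ} (ha : 0 < a) (hb : 0 < b)
    (hS : ∀ s, 0 < s → |∑ j, c j * exp (-s * (m j) ^ 2)| ≤ K * s ^ 2 * exp (-b * s))
    (hS' : ∀ s, 0 < s →
      |∑ j, c j * (m j) ^ 2 * exp (-s * (m j) ^ 2)| ≤ L * s * exp (-b * s)) :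
    IntegrableOn (fun s : ℝ => deriv (gEH c m a) s * s ^ (-(1 : ℝ) / 2)) (Ioi 0) := by
  refine integrableOn_of_abs_le_mul_exp
    (K := 3 / 2 * (K * a ^ 2) + L * a ^ 2 + K * a ^ 2) hb
    ((measurable_deriv _).mul (by fun_prop)).aestronglyMeasurable fun s hs => ?_
  rw [(hasDerivAt_gEH c m ha hs).deriv, gEHDeriv_mul_rpow c m a hs]
  have hsa := mul_pos hs ha
  have hh := abs_mul_coth_sub_one_le hsa
  have hh' : |(cosh (s * a) * sinh (s * a) - s * a) / sinh (s * a) ^ 2 * a| ≤ s * a * a := by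
    rw [abs_mul, abs_of_pos ha]
    gcongr
    exact abs_deriv_mul_coth_le hsa
  have b1 := abs_mul_div_le (hS s hs) hh (pow_pos hs 3)
  have b2 := abs_mul_div_le (hS' s hs) hh (pow_pos hs 2)
  have b3 := abs_mul_div_le (hS s hs) hh' (pow_pos hs 2)
  have e1 : K * s ^ 2 * exp (-b * s) * (s * a) ^ 2 / s ^ 3 = K * a ^ 2 * s * exp (-b * s) := by
    field_simp
  have e2 : L * s * exp (-b * s) * (s * a) ^ 2 / s ^ 2 = L * a ^ 2 * s * exp (-b * s) := by
    field_simp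
  have e3 : K * s ^ 2 * exp (-b * s) * (s * a * a) / s ^ 2 = K * a ^ 2 * s * exp (-b * s) := by
    field_simp
  rw [e1, abs_le] at b1
  rw [e2, abs_le] at b2
  rw [e3, abs_le] at b3
  rw [abs_le]
  constructor <;> linarith [b1.1, b1.2, b2.1, b2.2, b3.1, b3.2]

theorem tendsto_rpow_mul_gEH {l : Filter ℝ} {K b : ℝ} (ha : 0 < a)
    (hS : ∀ s, 0 < s → |∑ j, c j * exp (-s * (m j) ^ 2)| ≤ K * s ^ 2 * exp (-b * s))
    (hl : ∀ᶠ s in l, 0 < s) (hlim : Tendsto (fun s => s ^ 2 * exp (-b * s)) l (𝓝 0)) :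
    Tendsto ((fun s => s ^ (-(1 : ℝ) / 2)) * gEH c m a) l (𝓝 0) := by
  have h0 : Tendsto (fun s => K * a ^ 2 * (s ^ 2 * exp (-b * s))) l (𝓝 0) := by
    simpa using hlim.const_mul (K * a ^ 2)
  refine squeeze_zero_norm' (hl.mono fun s hs => ?_) h0
  rw [Pi.mul_apply, rpow_mul_gEH c m a hs, norm_eq_abs]
  refine (abs_mul_div_le (hS s hs) (abs_mul_coth_sub_one_le (mul_pos hs ha))
    (by positivity)).trans_eq ?_
  field_simp

theorem integral_deriv_gEH_mul_rpow {K L b : ℝ} (ha : 0 < a) (hb : 0 < b)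
    (hS : ∀ s, 0 < s → |∑ j, c j * exp (-s * (m j) ^ 2)| ≤ K * s ^ 2 * exp (-b * s))
    (hS' : ∀ s, 0 < s →
      |∑ j, c j * (m j) ^ 2 * exp (-s * (m j) ^ 2)| ≤ L * s * exp (-b * s)) :
    (∫ s in Ioi (0 : ℝ), deriv (gEH c m a) s * s ^ (-(1 : ℝ) / 2))
      = (1 / 2) * ∫ s in Ioi (0 : ℝ),
          (∑ j, c j * exp (-s * (m j) ^ 2)) * (s * a * coth (s * a) - 1) / s ^ 3 := by
  have hzero : Tendsto (fun s : ℝ => s ^ 2 * exp (-b * s)) (𝓝[>] 0) (𝓝 0) := by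
    have h : Continuous (fun s : ℝ => s ^ 2 * exp (-b * s)) := by fun_prop
    simpa using (h.tendsto 0).mono_left nhdsWithin_le_nhds
  have hinfty : Tendsto (fun s : ℝ => s ^ 2 * exp (-b * s)) atTop (𝓝 0) := by
    simpa using tendsto_rpow_mul_exp_neg_mul_atTop_nhds_zero 2 b hb
  have hparts := integral_Ioi_mul_deriv_eq_deriv_mul (a := 0)
    (u := fun s => s ^ (-(1 : ℝ) / 2)) (u' := fun s => -(1 : ℝ) / 2 * s ^ (-(3 : ℝ) / 2))
    (v := gEH c m a) (v' := deriv (gEH c m a))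
    (fun s (hs : 0 < s) => by
      refine (hasDerivAt_rpow_const (x := s) (p := -(1 : ℝ) / 2) (Or.inl hs.ne')).congr_deriv ?_
      norm_num)
    (fun s hs => (hasDerivAt_gEH c m ha hs).differentiableAt.hasDerivAt)
    ((integrableOn_deriv_gEH_mul_rpow ha hb hS hS').congr_fun
      (fun s _ => mul_comm _ _) measurableSet_Ioi)
    (IntegrableOn.congr_fun ((integrableOn_integrand ha hb hS).const_mul (-(1 / 2)))
      (fun s hs => (rpow_deriv_mul_gEH c m a hs).symm) measurableSet_Ioi)
    (tendsto_rpow_mul_gEH ha hS self_mem_nhdsWithin hzero)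
    (tendsto_rpow_mul_gEH ha hS (eventually_gt_atTop 0) hinfty)
  simp only [mul_comm (deriv (gEH c m a) _)]
  rw [hparts, setIntegral_congr_fun measurableSet_Ioi
    (fun s hs => rpow_deriv_mul_gEH c m a hs), integral_const_mul]
  ring

end Regularised

/-- Integration-by-parts identity extracting the zero-temperature Euler-Heisenberg
function: under the Pauli-Villars conditions, for `a > 0`,
`∫₀^∞ g'(s) s^{-1/2} ds = (1/2) ∫₀^∞ (∑_j c_j e^{-s m_j²})(s a coth(s a) - 1) s⁻³ ds`,
both integrals converging absolutely; equivalently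
`(1/(4π²)) ∫₀^∞ g'(s) s^{-1/2} ds = f⁰_PV(a)`. -/
theorem euler_heisenberg_integration_by_parts (c m : Fin 3 → ℝ) (a : ℝ)
    (hc0 : c 0 = 1) (hm0 : 0 < m 0) (hm01 : m 0 < m 1) (hm12 : m 1 < m 2)
    (hc : ∑ j, c j = 0) (hcm : ∑ j, c j * (m j) ^ 2 = 0) (ha : 0 < a) :
    IntegrableOn (fun s : ℝ => deriv (gEH c m a) s * s ^ (-(1 : ℝ) / 2)) (Set.Ioi 0) ∧
    IntegrableOn (fun s : ℝ =>
      (∑ j, c j * Real.exp (-s * (m j) ^ 2)) * (s * a * coth (s * a) - 1) / s ^ 3)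
      (Set.Ioi 0) ∧
    ((∫ s in Set.Ioi (0 : ℝ), deriv (gEH c m a) s * s ^ (-(1 : ℝ) / 2))
      = (1 / 2) * ∫ s in Set.Ioi (0 : ℝ),
          (∑ j, c j * Real.exp (-s * (m j) ^ 2)) * (s * a * coth (s * a) - 1) / s ^ 3) ∧
    (1 / (4 * π ^ 2)) * (∫ s in Set.Ioi (0 : ℝ), deriv (gEH c m a) s * s ^ (-(1 : ℝ) / 2))
      = f0PV c m a := by
  have hμ : ∀ j, (m 0) ^ 2 ≤ (m j) ^ 2 := fun j => by
    have : m 0 ≤ m j := by fin_cases j <;> simp <;> linarith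
    gcongr
  have hb : 0 < (m 0) ^ 2 := by positivity
  have hS := fun s (hs : 0 < s) => abs_sum_mul_exp_le_sq hc hcm hμ hs.le
  have hS' := fun s (hs : 0 < s) => abs_sum_mul_exp_le hcm hμ hs.le
  have heq := integral_deriv_gEH_mul_rpow ha hb hS hS'
  refine ⟨integrableOn_deriv_gEH_mul_rpow ha hb hS hS', integrableOn_integrand ha hb hS, heq, ?_⟩
  rw [heq, f0PV]
  ring
end
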